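/- arXiv:1711.06716 — 12 statements merged into one kernel-verified Lean document; each statement's English description precedes it below -/
import Mathlib

section
/- Let C be a category, A an object of C, and k a natural number. Suppose that among any k+1 objects of C each of which is dominated by A, at least two are isomorphic (i.e., A dominates at most k pairwise non-isomorphic objects). Then there is no s-chain of length k+1 for A; that is, there are no objects X_1, …, X_{k+1} with X_{k+1} <^s X_k <^s ⋯ <^s X_1 ≤^d A. (This expresses that the strong depth of A is at most its capacity.) -/
open CategoryTheory

universe v u

/-- `X` is dominated by `Y` (`X ≤ᵈ Y`): `X` is a retract of `Y`. -/
def Dominated {C : Type u} [Category.{v} C] (X Y : C) : Prop :=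
  ∃ (f : X ⟶ Y) (g : Y ⟶ X), f ≫ g = 𝟙 X

/-- `X` is strongly dominated by `Y` (`X <ˢ Y`). -/
def StronglyDominated {C : Type u} [Category.{v} C] (X Y : C) : Prop :=
  Dominated X Y ∧ ¬ Dominated Y X

/-- `X` is properly dominated by `Y` (`X <ᵖ Y`). -/
def ProperlyDominated {C : Type u} [Category.{v} C] (X Y : C) : Prop :=
  Dominated X Y ∧ ¬ Nonempty (X ≅ Y)

/-- `A` has the d-equality property. -/
def DEquality {C : Type u} [Category.{v} C] (A : C) : Prop :=
  ∀ X : C, Dominated X A → Dominated A X → Nonempty (X ≅ A)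

theorem Dominated.refl {C : Type u} [Category.{v} C] (X : C) : Dominated X X :=
  ⟨𝟙 X, 𝟙 X, Category.comp_id _⟩

theorem Dominated.trans {C : Type u} [Category.{v} C] {X Y Z : C}
    (hXY : Dominated X Y) (hYZ : Dominated Y Z) : Dominated X Z := by
  obtain ⟨f, g, hfg⟩ := hXY
  obtain ⟨f', g', hfg'⟩ := hYZ
  refine ⟨f ≫ f', g' ≫ g, ?_⟩
  rw [Category.assoc, reassoc_of% hfg', hfg]

theorem Dominated.of_iso {C : Type u} [Category.{v} C] {X Y : C} (e : X ≅ Y) : Dominated X Y :=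
  ⟨e.hom, e.inv, e.hom_inv_id⟩

theorem dominated_of_le_of_chain {C : Type u} [Category.{v} C] {k : ℕ} {X : ℕ → C}
    (hX : ∀ i, 1 ≤ i → i ≤ k → StronglyDominated (X (i + 1)) (X i))
    {m n : ℕ} (hm : 1 ≤ m) (hmn : m ≤ n) (hn : n ≤ k + 1) : Dominated (X n) (X m) := by
  induction n, hmn using Nat.le_induction with
  | base => exact Dominated.refl _
  | succ n hmn ih => exact (hX n (by omega) (by omega)).1.trans (ih (by omega))

theorem not_nonempty_iso_of_chain {C : Type u} [Category.{v} C] {k : ℕ} {X : ℕ → C}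
    (hX : ∀ i, 1 ≤ i → i ≤ k → StronglyDominated (X (i + 1)) (X i))
    {m n : ℕ} (hm : 1 ≤ m) (hmn : m < n) (hn : n ≤ k + 1) : ¬ Nonempty (X m ≅ X n) := by
  rintro ⟨e⟩
  exact (hX m hm (by omega)).2
    ((Dominated.of_iso e).trans (dominated_of_le_of_chain hX (by omega) hmn hn))

/-- If `A` dominates at most `k` pairwise non-isomorphic objects, then there is no
s-chain of length `k + 1` for `A`: the strong depth of `A` is at most its capacity. -/
theorem strongDepth_le_capacity
    {C : Type u} [Category.{v} C] (A : C) (k : ℕ)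
    (h : ∀ Y : Fin (k + 1) → C, (∀ i, Dominated (Y i) A) →
      ∃ i j, i ≠ j ∧ Nonempty (Y i ≅ Y j)) :
    ¬ ∃ X : ℕ → C, Dominated (X 1) A ∧
        ∀ i, 1 ≤ i → i ≤ k → StronglyDominated (X (i + 1)) (X i) := by
  rintro ⟨X, hA, hX⟩
  obtain ⟨i, j, hij, ⟨e⟩⟩ := h (fun i => X (i + 1)) fun i =>
    (dominated_of_le_of_chain hX le_rfl (by omega) (by omega)).trans hA
  rcases lt_or_gt_of_ne hij with hlt | hlt
  · exact not_nonempty_iso_of_chain hX (by omega) (by omega) (by omega) ⟨e⟩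
  · exact not_nonempty_iso_of_chain hX (by omega) (by omega) (by omega) ⟨e.symm⟩
end

section
/- Let C be a category, A an object of C, and k a natural number. Suppose there is no chain of length k+1 for A (i.e., the depth of A is at most k). Then every sequence of objects X : ℕ → Obj(C) with X_0 = A and X_{n+1} ≤^d X_n for all n contains at most k different objects up to isomorphism: any finite set of indices n ≥ 1 whose corresponding objects X_n are pairwise non-isomorphic has at most k elements. -/
open CategoryTheory

universe v u

theorem Dominated.of_le {C : Type u} [Category.{v} C] {X : ℕ → C}
    (hX : ∀ n, Dominated (X (n + 1)) (X n)) {m n : ℕ} (hmn : m ≤ n) :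
    Dominated (X n) (X m) := by
  induction n, hmn using Nat.le_induction with
  | base => exact .refl _
  | succ n _ ih => exact (hX n).trans ih

/-- If there is no chain of length `k + 1` for `A` (i.e. `D(A) ≤ k`), then every
descending sequence of dominations starting at `A` contains at most `k` different
objects up to isomorphism. -/
theorem depth_le_imp_sequence_few_classes
    {C : Type u} [Category.{v} C] (A : C) (k : ℕ)
    (h : ¬ ∃ X : ℕ → C, Dominated (X 1) A ∧
        ∀ i, 1 ≤ i → i ≤ k → ProperlyDominated (X (i + 1)) (X i)) :
    ∀ X : ℕ → C, X 0 = A → (∀ n, Dominated (X (n + 1)) (X n)) →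
      ∀ s : Finset ℕ, (∀ n ∈ s, 1 ≤ n) →
        (∀ m ∈ s, ∀ n ∈ s, m ≠ n → ¬ Nonempty (X m ≅ X n)) → s.card ≤ k := by
  intro X hX0 hX s _ hs
  by_contra! hk
  let e := s.orderEmbOfFin rfl
  let idx : ℕ → ℕ := fun i => if hi : i - 1 < s.card then e ⟨i - 1, hi⟩ else 0
  refine h ⟨fun i => X (idx i), hX0 ▸ Dominated.of_le hX (Nat.zero_le _), fun i hi hik => ?_⟩
  have hi₁ : i - 1 < s.card := by omega
  have hi₂ : i + 1 - 1 < s.card := by omega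
  have hlt : e ⟨i - 1, hi₁⟩ < e ⟨i + 1 - 1, hi₂⟩ :=
    e.strictMono (Fin.mk_lt_mk.mpr (by omega))
  simp only [idx, dif_pos hi₁, dif_pos hi₂]
  exact ⟨Dominated.of_le hX hlt.le,
    hs _ (s.orderEmbOfFin_mem rfl _) _ (s.orderEmbOfFin_mem rfl _) hlt.ne'⟩
end

section
/- Let C be a category and A an object of C of finite depth, i.e., there exists a natural number k such that there is no chain of length k+1 for A. Then every object X with X ≤^d A has the d-equality property. -/
open CategoryTheory

universe v u

/-- If `A` has finite depth (for some `k` there is no chain of length `k + 1` for `A`),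
then every object dominated by `A` has the d-equality property. -/
theorem dEquality_of_finite_depth
    {C : Type u} [Category.{v} C] (A : C)
    (h : ∃ k : ℕ, ¬ ∃ X : ℕ → C, Dominated (X 1) A ∧
        ∀ i, 1 ≤ i → i ≤ k → ProperlyDominated (X (i + 1)) (X i)) :
    ∀ X : C, Dominated X A → DEquality X := by
  obtain ⟨k, hk⟩ := h
  intro X hXA Y hYX hXY
  by_contra hne
  -- Otherwise `X, Y, X, Y, …` gives chains of arbitrary length for `A`.
  refine hk ⟨fun i => if Even i then Y else X, by simpa using hXA, fun i _ _ => ?_⟩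
  by_cases hi : Even i
  · have hXY' : ProperlyDominated X Y := ⟨hXY, fun ⟨e⟩ => hne ⟨e.symm⟩⟩
    simpa [Nat.even_add_one, hi] using hXY'
  · have hYX' : ProperlyDominated Y X := ⟨hYX, hne⟩
    simpa [Nat.even_add_one, hi] using hYX'
end

section
/- Every Hopfian group has the d-equality property: if G is a Hopfian group and H is a group such that H ≤^d G and G ≤^d H, then G and H are isomorphic. -/
universe u v

/-- `H ≤ᵈ G` in the category of groups: `H` is an r-image of `G`. -/
def GrpDominated (H : Type u) (G : Type v) [Group H] [Group G] : Prop :=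
  ∃ (g : G →* H) (f : H →* G), ∀ h, g (f h) = h

/-- A group is Hopfian if every surjective endomorphism is injective. -/
def IsHopfianGroup (G : Type u) [Group G] : Prop :=
  ∀ φ : G →* G, Function.Surjective φ → Function.Injective φ

/-- Every Hopfian group has the d-equality property. -/
theorem hopfian_dEquality (G : Type u) [Group G] (hG : IsHopfianGroup G)
    (H : Type v) [Group H] (h1 : GrpDominated H G) (h2 : GrpDominated G H) :
    Nonempty (G ≃* H) := by
  obtain ⟨g, f, hgf⟩ := h1
  obtain ⟨g', f', hgf'⟩ := h2
  have g_surj : Function.Surjective g := Function.LeftInverse.surjective hgf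
  have g'_surj : Function.Surjective g' := Function.LeftInverse.surjective hgf'
  have comp_inj : Function.Injective (g' ∘ g) := hG (g'.comp g) (g'_surj.comp g_surj)
  exact ⟨MulEquiv.ofBijective g ⟨comp_inj.of_comp, g_surj⟩⟩
end

section
/- Let G be a Hopfian group and H a group with H ≤^d G and H not isomorphic to G. Then G ≤^d H fails; that is, every group properly dominated by a Hopfian group G is strongly dominated by G. (This expresses that SC(G) = C(G) − 1 for Hopfian G.) -/
universe u v

/-- A group properly dominated by a Hopfian group `G` is strongly dominated by `G`
(this expresses `SC(G) = C(G) - 1` for Hopfian `G`). -/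
theorem hopfian_proper_implies_strong (G : Type u) [Group G] (hG : IsHopfianGroup G)
    (H : Type v) [Group H] (h1 : GrpDominated H G) (h2 : ¬ Nonempty (H ≃* G)) :
    ¬ GrpDominated G H := by
  rintro ⟨p, s, hps⟩
  obtain ⟨g, f, hgf⟩ := h1
  have hg : Function.Surjective g := Function.RightInverse.surjective hgf
  have hp : Function.Surjective p := Function.RightInverse.surjective hps
  have hpg : Function.Injective (p ∘ g) := hG (p.comp g) (hp.comp hg)
  exact h2 ⟨(MulEquiv.ofBijective g ⟨hpg.of_comp, hg⟩).symm⟩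
end

section
/- Let F be a free group of finite rank k (e.g., F = FreeGroup (Fin k)). If H is a group with H ≤^d F, then H is isomorphic to a free group of rank m for some m ≤ k; if moreover H is not isomorphic to F, then m < k. -/
universe u v

/-- The domain of an injective homomorphism into a free group is free. -/
theorem isFreeGroup_of_injective {H : Type u} {F : Type v} [Group H] [Group F] [IsFreeGroup F]
    (f : H →* F) (hf : Function.Injective f) : IsFreeGroup H :=
  IsFreeGroup.ofMulEquiv (MonoidHom.ofInjective hf).symm

/-- A surjection of free groups does not increase the rank, since homomorphisms out of the target
into a group of order two inject into those out of the source. -/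
theorem FreeGroup.finite_and_card_le_of_surjective {X : Type u} {Y : Type v} [Finite Y]
    (g : FreeGroup Y →* FreeGroup X) (hg : Function.Surjective g) :
    Finite X ∧ Nat.card X ≤ Nat.card Y := by
  let A := Multiplicative (ZMod 2)
  have hA : Nat.card A = 2 := Nat.card_zmod 2
  have : Finite A := Nat.finite_of_card_ne_zero (hA ▸ two_ne_zero)
  have : Nontrivial A := Finite.one_lt_card_iff_nontrivial.1 (hA ▸ one_lt_two)
  let Φ : (X → A) → (Y → A) := fun φ => FreeGroup.lift.symm ((FreeGroup.lift φ).comp g)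
  have hΦ : Function.Injective Φ := fun φ ψ h =>
    FreeGroup.lift.injective <| (MonoidHom.cancel_right hg).1 <| FreeGroup.lift.symm.injective h
  have : Finite (X → A) := Finite.of_injective Φ hΦ
  have hX : Finite X := by
    classical
    obtain ⟨a, ha⟩ := exists_ne (1 : A)
    exact Finite.of_injective (fun x : X => (Pi.mulSingle x a : X → A))
      fun x y h => by
        by_contra hxy
        have := congrFun h x
        simp [Pi.mulSingle_eq_of_ne hxy, ha] at this
  refine ⟨hX, ?_⟩
  have h := Nat.card_le_card_of_injective Φ hΦ
  rw [Nat.card_fun, Nat.card_fun, hA] at h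
  exact (Nat.pow_le_pow_iff_right one_lt_two).1 h

/-- An r-image of a free group of rank `k` is free of rank `m ≤ k`; a proper r-image is
free of rank `m < k`. -/
theorem rImage_of_freeGroup (k : ℕ) (H : Type u) [Group H]
    (h : GrpDominated H (FreeGroup (Fin k))) :
    ∃ m ≤ k, Nonempty (H ≃* FreeGroup (Fin m)) ∧
      (¬ Nonempty (H ≃* FreeGroup (Fin k)) → m < k) := by
  obtain ⟨g, f, hgf⟩ := h
  have := isFreeGroup_of_injective f (Function.LeftInverse.injective hgf)
  let e := IsFreeGroup.toFreeGroup H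
  have hg : Function.Surjective (e.toMonoidHom.comp g) :=
    e.surjective.comp (Function.LeftInverse.surjective hgf)
  obtain ⟨_, hle⟩ := FreeGroup.finite_and_card_le_of_surjective _ hg
  rw [Nat.card_fin] at hle
  have hH : Nonempty (H ≃* FreeGroup (Fin (Nat.card (IsFreeGroup.Generators H)))) :=
    ⟨e.trans (FreeGroup.freeGroupCongr (Finite.equivFin _))⟩
  exact ⟨_, hle, hH, fun hne => hle.lt_of_ne fun heq => hne (heq ▸ hH)⟩
end

section
/- Let F be a free group of finite rank k (F = FreeGroup (Fin k)). A group H satisfies H ≤^d F if and only if H is isomorphic to FreeGroup (Fin m) for some m ≤ k. Since free groups of distinct finite ranks are non-isomorphic, F dominates exactly k+1 isomorphism classes of groups, i.e., the capacity of F is k+1. -/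
universe u v

/-- A homomorphism from one free group onto another cannot increase the rank. -/
theorem FreeGroup.finite_and_card_le_of_surjective_s12 {α : Type*} {β : Type*} [Finite α]
    (φ : FreeGroup α →* FreeGroup β) (hφ : Function.Surjective φ) :
    Finite β ∧ Nat.card β ≤ Nat.card α := by
  let res : (β → Multiplicative (ZMod 2)) → (α → Multiplicative (ZMod 2)) :=
    fun u => FreeGroup.lift.symm ((FreeGroup.lift u).comp φ)
  have hres : Function.Injective res := fun u v huv =>
    FreeGroup.lift.injective <|
      (MonoidHom.cancel_right hφ).1 (FreeGroup.lift.symm.injective huv)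
  have : Finite (Multiplicative (ZMod 2)) := inferInstanceAs (Finite (ZMod 2))
  have : Finite (β → Multiplicative (ZMod 2)) := Finite.of_injective res hres
  have hβ : Finite β := by
    classical
    have hne : Multiplicative.ofAdd (1 : ZMod 2) ≠ 1 := by decide
    refine Finite.of_injective
      (fun b : β => (Pi.mulSingle b (Multiplicative.ofAdd 1) : β → Multiplicative (ZMod 2)))
      fun a b hab => ?_
    by_contra h
    have := congrFun hab a
    simp only [Pi.mulSingle_eq_same, Pi.mulSingle_eq_of_ne h] at this
    exact hne this
  refine ⟨hβ, ?_⟩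
  have hcard := Nat.card_le_card_of_injective res hres
  have h2 : Nat.card (Multiplicative (ZMod 2)) = 2 := Nat.card_zmod 2
  rw [Nat.card_fun, Nat.card_fun, h2] at hcard
  exact (Nat.pow_le_pow_iff_right one_lt_two).1 hcard

theorem FreeGroup.rank_le_of_surjective {m n : ℕ}
    (φ : FreeGroup (Fin m) →* FreeGroup (Fin n)) (hφ : Function.Surjective φ) : n ≤ m := by
  simpa using (FreeGroup.finite_and_card_le_of_surjective_s12 φ hφ).2

/-- An r-image of a free group of finite rank is free of no larger rank. -/
theorem GrpDominated.exists_mulEquiv_freeGroup {H : Type u} [Group H] {k : ℕ}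
    (hd : GrpDominated H (FreeGroup (Fin k))) :
    ∃ m ≤ k, Nonempty (H ≃* FreeGroup (Fin m)) := by
  obtain ⟨g, f, hgf⟩ := hd
  let e : H ≃* FreeGroup (IsFreeGroup.Generators f.range) :=
    (MonoidHom.ofInjective (Function.LeftInverse.injective hgf)).trans
      (IsFreeGroup.toFreeGroup f.range)
  obtain ⟨hfin, hcard⟩ := FreeGroup.finite_and_card_le_of_surjective_s12
    (e.toMonoidHom.comp g) (e.surjective.comp (Function.LeftInverse.surjective hgf))
  rw [Nat.card_fin] at hcard
  exact ⟨_, hcard, ⟨e.trans (FreeGroup.freeGroupCongr (Finite.equivFin _))⟩⟩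

theorem GrpDominated.of_mulEquiv_freeGroup {H : Type u} [Group H] {m k : ℕ} (hmk : m ≤ k)
    (e : H ≃* FreeGroup (Fin m)) : GrpDominated H (FreeGroup (Fin k)) := by
  let i : FreeGroup (Fin m) →* FreeGroup (Fin k) := FreeGroup.map (Fin.castLE hmk)
  let r : FreeGroup (Fin k) →* FreeGroup (Fin m) :=
    FreeGroup.lift fun j => if h : (j : ℕ) < m then FreeGroup.of ⟨j, h⟩ else 1
  have hri : r.comp i = MonoidHom.id _ := by
    ext j
    simp [r, i]
  refine ⟨e.symm.toMonoidHom.comp r, i.comp e.toMonoidHom, fun h => ?_⟩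
  have := DFunLike.congr_fun hri (e h)
  simp only [MonoidHom.comp_apply, MonoidHom.id_apply] at this
  simp [this]

/-- A group `H` is dominated by the free group of rank `k` iff `H` is free of rank
`m ≤ k`; together with the fact that free groups of distinct finite ranks are
non-isomorphic this says that the capacity of `FreeGroup (Fin k)` is `k + 1`. -/
theorem capacity_of_freeGroup (k : ℕ) :
    (∀ (H : Type u) [Group H],
      GrpDominated H (FreeGroup (Fin k)) ↔
        ∃ m ≤ k, Nonempty (H ≃* FreeGroup (Fin m))) ∧
    (∀ m n : ℕ, Nonempty (FreeGroup (Fin m) ≃* FreeGroup (Fin n)) → m = n) := by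
  refine ⟨fun H _ => ⟨GrpDominated.exists_mulEquiv_freeGroup, ?_⟩, ?_⟩
  · rintro ⟨m, hmk, ⟨e⟩⟩
    exact GrpDominated.of_mulEquiv_freeGroup hmk e
  · rintro m n ⟨e⟩
    exact le_antisymm (FreeGroup.rank_le_of_surjective e.symm.toMonoidHom e.symm.surjective)
      (FreeGroup.rank_le_of_surjective e.toMonoidHom e.surjective)
end

section
/- Let q_1, …, q_n be pairwise distinct prime powers, let k_0, k_1, …, k_n be natural numbers, and let G = ℤ^{k_0} × (ℤ/q_1)^{k_1} × ⋯ × (ℤ/q_n)^{k_n}. Then a group H satisfies H ≤^d G if and only if H ≅ ℤ^{t_0} × (ℤ/q_1)^{t_1} × ⋯ × (ℤ/q_n)^{t_n} for some t_0 ≤ k_0, …, t_n ≤ k_n. Consequently the capacity of G is (k_0+1)(k_1+1)⋯(k_n+1). -/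
universe u

/-- `H ≤ᵈ G` in the category of groups (additive notation): `H` is an r-image of `G`. -/
def AddGrpDominated (H : Type u) (G : Type*) [AddGroup H] [AddGroup G] : Prop :=
  ∃ (g : G →+ H) (f : H →+ G), ∀ h, g (f h) = h

open Finset

section PiZMod

variable {ι κ : Type*}

theorem natCard_zmod_hom (n m : ℕ) [NeZero m] : Nat.card (ZMod n →+ ZMod m) = n.gcd m := by
  have e : (ZMod n →+ ZMod m) ≃ (nsmulAddMonoidHom n : ZMod m →+ ZMod m).ker :=
    (ZMod.lift n).symm.trans
      ((zmultiplesHom (ZMod m)).symm.subtypeEquiv fun f => by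
        have : f n = n • f 1 := by rw [← map_nsmul]; simp
        simp [AddMonoidHom.mem_ker, this])
  rw [Nat.card_congr e, IsAddCyclic.card_nsmulAddMonoidHom_ker, Nat.card_zmod, Nat.gcd_comm]

theorem natCard_pi_zmod_hom [Fintype ι] (Q : ι → ℕ) (m : ℕ) [NeZero m] :
    Nat.card ((∀ i, ZMod (Q i)) →+ ZMod m) = ∏ i, (Q i).gcd m := by
  classical
  have e : ((∀ i, ZMod (Q i)) →+ ZMod m) ≃ ∀ i, (ZMod (Q i) →+ ZMod m) :=
    (addMonoidHomLequivInt ℤ).toEquiv.trans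
      ((LinearMap.lsum ℤ (fun i => ZMod (Q i)) ℤ).symm.toEquiv.trans
        (Equiv.piCongrRight fun i => (addMonoidHomLequivInt ℤ).symm.toEquiv))
  rw [Nat.card_congr e, Nat.card_pi]
  simp only [natCard_zmod_hom]

theorem gcd_prime_pow_sq {p e n : ℕ} (hp : p.Prime) (hn : n = 0 ∨ IsPrimePow n) :
    n.gcd (p ^ (e + 1)) ^ 2 =
      n.gcd (p ^ e) * n.gcd (p ^ (e + 2)) * if n = p ^ (e + 1) then p else 1 := by
  rcases hn with rfl | hn
  · rw [if_neg (pow_pos hp.pos _).ne]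
    simp only [Nat.gcd_zero_left]
    ring
  obtain ⟨l, r, hl, hr, rfl⟩ := (isPrimePow_nat_iff _).1 hn
  by_cases hlp : l = p
  · subst hlp
    have key : ∀ a b : ℕ, (l ^ a).gcd (l ^ b) = l ^ min a b := fun a b => by
      rcases le_total a b with h | h
      · rw [min_eq_left h, Nat.gcd_eq_left (pow_dvd_pow _ h)]
      · rw [min_eq_right h, Nat.gcd_eq_right (pow_dvd_pow _ h)]
    simp only [key, Nat.pow_right_inj hl.two_le]
    split_ifs with h
    · rw [← pow_mul, ← pow_add, ← pow_succ]
      congr 1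
      omega
    · rw [← pow_mul, ← pow_add, mul_one]
      congr 1
      omega
  · have key : ∀ b, (l ^ r).gcd (p ^ b) = 1 := fun b =>
      ((Nat.coprime_primes hl hp).2 hlp).pow r b
    have : l ^ r ≠ p ^ (e + 1) := fun h => hlp <|
      (Nat.prime_dvd_prime_iff_eq hl hp).1 <|
        hl.dvd_of_dvd_pow (h ▸ dvd_pow_self l hr.ne')
    simp [key, this]

theorem prod_gcd_prime_pow_sq [Fintype ι] (Q : ι → ℕ) (hQ : ∀ i, Q i = 0 ∨ IsPrimePow (Q i))
    {p : ℕ} (hp : p.Prime) (e : ℕ) :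
    (∏ i, (Q i).gcd (p ^ (e + 1))) ^ 2 =
      (∏ i, (Q i).gcd (p ^ e)) * (∏ i, (Q i).gcd (p ^ (e + 2))) *
        p ^ #{i | Q i = p ^ (e + 1)} := by
  rw [← prod_pow, ← prod_mul_distrib, prod_congr rfl fun i _ => gcd_prime_pow_sq hp (hQ i),
    prod_mul_distrib, prod_ite]
  simp

theorem prod_gcd_eq_pow_card [Fintype ι] (Q : ι → ℕ) {m : ℕ}
    (hm : ∀ i, Q i ≠ 0 → (Q i).Coprime m) : ∏ i, (Q i).gcd m = m ^ #{i | Q i = 0} := by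
  have : ∀ i, (Q i).gcd m = if Q i = 0 then m else 1 := fun i => by
    split_ifs with h
    · simp [h]
    · exact hm i h
  simp [this, prod_ite]

/-- The orders of the cyclic factors, if zero or prime powers, are determined up to order
by the numbers of homomorphisms to finite cyclic groups. -/
theorem card_filter_eq_of_prod_gcd_eq [Fintype ι] [Fintype κ] {Q : ι → ℕ} {R : κ → ℕ}
    (hQ : ∀ i, Q i = 0 ∨ IsPrimePow (Q i)) (hR : ∀ j, R j = 0 ∨ IsPrimePow (R j))
    (h : ∀ m ≠ 0, ∏ i, (Q i).gcd m = ∏ j, (R j).gcd m) (n : ℕ) :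
    #{i | Q i = n} = #{j | R j = n} := by
  by_cases hn : n = 0 ∨ IsPrimePow n
  · rcases hn with rfl | hn
    · set a := ∏ i with Q i ≠ 0, Q i
      set b := ∏ j with R j ≠ 0, R j
      have ha : a ≠ 0 := prod_ne_zero_iff.2 fun i hi => (mem_filter.1 hi).2
      have hb : b ≠ 0 := prod_ne_zero_iff.2 fun i hi => (mem_filter.1 hi).2
      have hcop : (a * b).Coprime (a * b + 1) := by simp
      have key := h (a * b + 1) (by omega)
      rw [prod_gcd_eq_pow_card Q fun i hi => hcop.coprime_dvd_left
          ((dvd_prod_of_mem Q (by simpa using hi)).trans (Dvd.intro _ rfl)),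
        prod_gcd_eq_pow_card R fun j hj => hcop.coprime_dvd_left
          ((dvd_prod_of_mem R (by simpa using hj)).trans (Dvd.intro_left _ rfl))] at key
      have : 0 < a * b := Nat.pos_of_ne_zero (mul_ne_zero ha hb)
      exact Nat.pow_right_injective (by omega : 2 ≤ a * b + 1) key
    · obtain ⟨p, r, hp, hr, rfl⟩ := (isPrimePow_nat_iff _).1 hn
      obtain ⟨e, rfl⟩ := Nat.exists_eq_succ_of_ne_zero hr.ne'
      have hpe : ∀ b, p ^ b ≠ 0 := fun b => (pow_pos hp.pos b).ne'
      have h₁ := prod_gcd_prime_pow_sq Q hQ hp e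
      have h₂ := prod_gcd_prime_pow_sq R hR hp e
      rw [h _ (hpe _), h _ (hpe _), h _ (hpe _), h₂] at h₁
      have hpos : ∀ b, 0 < ∏ j, (R j).gcd (p ^ b) := fun b =>
        prod_pos fun j _ => Nat.gcd_pos_of_pos_right _ (pow_pos hp.pos b)
      exact (Nat.pow_right_injective hp.two_le
        (Nat.eq_of_mul_eq_mul_left (Nat.mul_pos (hpos _) (hpos _)) h₁)).symm
  · rw [card_eq_zero.2, card_eq_zero.2] <;> rw [filter_eq_empty_iff]
    · rintro j - rfl
      exact hn (hR j)
    · rintro i - rfl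
      exact hn (hQ i)

/-- Uniqueness in the structure theorem of finitely generated abelian groups. -/
theorem card_filter_eq_of_pi_zmod_equiv [Fintype ι] [Fintype κ] {Q : ι → ℕ} {R : κ → ℕ}
    (hQ : ∀ i, Q i = 0 ∨ IsPrimePow (Q i)) (hR : ∀ j, R j = 0 ∨ IsPrimePow (R j))
    (e : (∀ i, ZMod (Q i)) ≃+ ∀ j, ZMod (R j)) (n : ℕ) :
    #{i | Q i = n} = #{j | R j = n} := by
  refine card_filter_eq_of_prod_gcd_eq hQ hR (fun m hm => ?_) n
  have : NeZero m := ⟨hm⟩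
  rw [← natCard_pi_zmod_hom, ← natCard_pi_zmod_hom, Nat.card_congr e.addMonoidHomCongrLeftEquiv]

theorem nonempty_pi_zmod_equiv_of_card_filter_eq [Fintype ι] [Fintype κ] {Q : ι → ℕ} {R : κ → ℕ}
    (h : ∀ n, #{i | Q i = n} = #{j | R j = n}) :
    Nonempty ((∀ i, ZMod (Q i)) ≃+ ∀ j, ZMod (R j)) := by
  have hfib : ∀ n, Nonempty ({i // Q i = n} ≃ {j // R j = n}) := fun n =>
    Fintype.card_eq.1 (by simpa only [Fintype.card_subtype] using h n)
  obtain ⟨e, he⟩ : ∃ e : ι ≃ κ, ∀ i, R (e i) = Q i :=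
    ⟨(Equiv.sigmaFiberEquiv Q).symm.trans
      ((Equiv.sigmaCongrRight fun n => (hfib n).some).trans (Equiv.sigmaFiberEquiv R)),
      fun i => ((hfib (Q i)).some ⟨i, rfl⟩).2⟩
  obtain rfl : Q = fun i => R (e i) := funext fun i => (he i).symm
  exact ⟨(LinearEquiv.piCongrLeft ℤ (fun j => ZMod (R j)) e).toAddEquiv⟩

theorem exists_equiv_pi_zmod (A : Type*) [AddCommGroup A] [AddGroup.FG A] :
    ∃ (ι : Type) (_ : Fintype ι) (Q : ι → ℕ), (∀ i, Q i = 0 ∨ IsPrimePow (Q i)) ∧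
      Nonempty (A ≃+ ∀ i, ZMod (Q i)) := by
  classical
  obtain ⟨n, ι, _, p, hp, e, ⟨f⟩⟩ := AddCommGroup.equiv_free_prod_directSum_zmod A
  let r : (∀ i, ZMod (p i ^ e i)) →+ ∀ i : {i // e i ≠ 0}, ZMod (p i ^ e i) :=
    { toFun := fun x i => x i, map_zero' := rfl, map_add' := fun _ _ => rfl }
  have hr : Function.Bijective r := by
    refine ⟨fun x y hxy => funext fun i => ?_, fun y =>
      ⟨fun i => if h : e i ≠ 0 then y ⟨i, h⟩ else 0,
      funext fun i => dif_pos i.2⟩⟩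
    by_cases h : e i = 0
    · have : Subsingleton (ZMod (p i ^ e i)) := by rw [h, pow_zero]; infer_instance
      exact Subsingleton.elim _ _
    · exact congrFun hxy ⟨i, h⟩
  refine ⟨Fin n ⊕ {i // e i ≠ 0}, inferInstance,
    Sum.elim (fun _ => 0) fun i => p i ^ e i, ?_, ⟨f.trans ?_⟩⟩
  · rintro (i | i)
    · exact Or.inl rfl
    · exact Or.inr ((hp i).isPrimePow.pow i.2)
  · exact (Finsupp.addEquivFunOnFinite.prodCongr
      ((DirectSum.addEquivProd _).trans (AddEquiv.ofBijective r hr))).trans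
      (LinearEquiv.sumPiEquivProdPi ℤ _ _ fun i =>
        ZMod (Sum.elim (fun _ => 0) (fun i : {i // e i ≠ 0} => p i ^ e i) i)).symm.toAddEquiv

end PiZMod

section Dominated

theorem AddGrpDominated.of_equiv {H : Type u} {H' G : Type*} [AddGroup H] [AddGroup H']
    [AddGroup G] (e : H ≃+ H') {g : G →+ H'} {f : H' →+ G} (h : ∀ x, g (f x) = x) :
    AddGrpDominated H G :=
  ⟨e.symm.toAddMonoidHom.comp g, f.comp e.toAddMonoidHom, fun x => by simp [h]⟩

/-- A retract of an abelian group is a direct factor. -/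
def equivProdKerOfLeftInverse {H G : Type*} [AddCommGroup H] [AddCommGroup G]
    (g : G →+ H) (f : H →+ G) (h : ∀ x, g (f x) = x) : G ≃+ H × g.ker where
  toFun x := (g x, ⟨x - f (g x), by simp [AddMonoidHom.mem_ker, h]⟩)
  invFun y := f y.1 + y.2
  left_inv x := by simp
  right_inv y := by
    have : g (y.2 : G) = 0 := y.2.2
    ext <;> simp [h, this]
  map_add' x y := by
    ext
    · simp
    · simp
      abel

theorem exists_retraction_pi_fin (A : Type*) [AddGroup A] {a b : ℕ} (hab : a ≤ b) :
    ∃ (g : (Fin b → A) →+ (Fin a → A)) (f : (Fin a → A) →+ (Fin b → A)), ∀ x, g (f x) = x := by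
  refine ⟨{ toFun := fun x j => x (Fin.castLE hab j)
            map_zero' := rfl, map_add' := fun _ _ => rfl },
    { toFun := fun x j => if h : (j : ℕ) < a then x ⟨j, h⟩ else 0
      map_zero' := by ext; simp
      map_add' := fun x y => by
        ext j
        by_cases h : (j : ℕ) < a <;> simp [h] }, fun x => ?_⟩
  ext j
  simp

end Dominated

section Standard

variable {n : ℕ} (q : Fin n → ℕ)

/-- The orders of the cyclic factors of `ℤ^{t₀} × (ℤ/q₁)^{t₁} × ⋯ × (ℤ/qₙ)^{tₙ}`. -/
def cyclicOrders (t₀ : ℕ) (t : Fin n → ℕ) : Fin t₀ ⊕ (Σ i, Fin (t i)) → ℕ :=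
  Sum.elim (fun _ => 0) fun x => q x.1

/-- `ℤ^{t₀} × (ℤ/q₁)^{t₁} × ⋯ × (ℤ/qₙ)^{tₙ}` as a single product of cyclic groups. -/
def prodPiEquivPiCyclicOrders (t₀ : ℕ) (t : Fin n → ℕ) :
    ((Fin t₀ → ℤ) × ((i : Fin n) → Fin (t i) → ZMod (q i))) ≃+
      ∀ x, ZMod (cyclicOrders q t₀ t x) :=
  ((AddEquiv.refl _).prodCongr
    (LinearEquiv.piCurry ℤ fun i (_ : Fin (t i)) => ZMod (q i)).symm.toAddEquiv).trans
    (LinearEquiv.sumPiEquivProdPi ℤ _ _ fun x => ZMod (cyclicOrders q t₀ t x)).symm.toAddEquiv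

variable {q}

theorem cyclicOrders_eq_zero_or_isPrimePow (hq : ∀ i, IsPrimePow (q i)) (t₀ : ℕ) (t : Fin n → ℕ)
    (x) : cyclicOrders q t₀ t x = 0 ∨ IsPrimePow (cyclicOrders q t₀ t x) := by
  rcases x with x | x
  · exact Or.inl rfl
  · exact Or.inr (hq x.1)

theorem card_cyclicOrders (t₀ : ℕ) (t : Fin n → ℕ) (m : ℕ) :
    #{x | cyclicOrders q t₀ t x = m} =
      (if 0 = m then t₀ else 0) + ∑ i, if q i = m then t i else 0 := by
  rw [card_filter, Fintype.sum_sum_type, Fintype.sum_sigma]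
  change (∑ _ : Fin t₀, if 0 = m then 1 else 0) +
    (∑ i, ∑ _ : Fin (t i), if q i = m then 1 else 0) = _
  simp

theorem card_cyclicOrders_zero (hq : ∀ i, IsPrimePow (q i)) (t₀ : ℕ) (t : Fin n → ℕ) :
    #{x | cyclicOrders q t₀ t x = 0} = t₀ := by
  simp [card_cyclicOrders, (hq _).ne_zero]

theorem card_cyclicOrders_apply (hq : ∀ i, IsPrimePow (q i)) (hq' : Function.Injective q)
    (t₀ : ℕ) (t : Fin n → ℕ) (i : Fin n) : #{x | cyclicOrders q t₀ t x = q i} = t i := by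
  simp [card_cyclicOrders, (hq _).ne_zero.symm, hq'.eq_iff]

theorem card_cyclicOrders_of_notMem {m : ℕ} (hm₀ : m ≠ 0) (hm : m ∉ Set.range q)
    (t₀ : ℕ) (t : Fin n → ℕ) : #{x | cyclicOrders q t₀ t x = m} = 0 := by
  rw [card_cyclicOrders, if_neg hm₀.symm, zero_add]
  exact sum_eq_zero fun i _ => if_neg fun h => hm ⟨i, h⟩

end Standard

/-- For `G = ℤ^{k₀} × (ℤ/q₁)^{k₁} × ⋯ × (ℤ/qₙ)^{kₙ}` (the `qᵢ` pairwise distinct prime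
powers), a group `H` satisfies `H ≤ᵈ G` iff `H ≅ ℤ^{t₀} × (ℤ/q₁)^{t₁} × ⋯ × (ℤ/qₙ)^{tₙ}`
for some `tᵢ ≤ kᵢ`; the representatives being pairwise non-isomorphic, the capacity of
`G` is `(k₀+1)(k₁+1)⋯(kₙ+1)`. -/
theorem capacity_of_fg_abelian (n : ℕ) (q : Fin n → ℕ)
    (hq : ∀ i, IsPrimePow (q i)) (hq' : Function.Injective q)
    (k₀ : ℕ) (k : Fin n → ℕ) :
    (∀ (H : Type u) [AddGroup H],
      AddGrpDominated H ((Fin k₀ → ℤ) × ((i : Fin n) → Fin (k i) → ZMod (q i))) ↔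
        ∃ (t₀ : ℕ) (t : Fin n → ℕ), t₀ ≤ k₀ ∧ (∀ i, t i ≤ k i) ∧
          Nonempty (H ≃+ (Fin t₀ → ℤ) × ((i : Fin n) → Fin (t i) → ZMod (q i)))) ∧
    (∀ (t₀ t₀' : ℕ) (t t' : Fin n → ℕ),
      Nonempty (((Fin t₀ → ℤ) × ((i : Fin n) → Fin (t i) → ZMod (q i))) ≃+
          ((Fin t₀' → ℤ) × ((i : Fin n) → Fin (t' i) → ZMod (q i)))) →
      t₀ = t₀' ∧ t = t') := by
  refine ⟨fun H _ => ⟨?_, ?_⟩, fun t₀ t₀' t t' ⟨e⟩ => ?_⟩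
  · rintro ⟨g, f, hgf⟩
    let _ : AddCommGroup H := { ‹AddGroup H› with
      add_comm := fun a b => by rw [← hgf (a + b), map_add, add_comm, ← map_add, hgf] }
    have (i : Fin n) : NeZero (q i) := ⟨(hq i).ne_zero⟩
    have hfg : AddGroup.FG ((Fin k₀ → ℤ) × ((i : Fin n) → Fin (k i) → ZMod (q i))) :=
      Module.Finite.iff_addGroup_fg.1 inferInstance
    let E := equivProdKerOfLeftInverse g f hgf
    have : AddGroup.FG H := AddGroup.fg_of_surjective (f := g) fun x => ⟨f x, hgf x⟩
    have : AddGroup.FG g.ker := AddGroup.fg_of_surjective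
      (f := (AddMonoidHom.snd H g.ker).comp E.toAddMonoidHom)
      (Prod.snd_surjective.comp E.surjective)
    obtain ⟨ι, _, Q, hQ, ⟨eH⟩⟩ := exists_equiv_pi_zmod H
    obtain ⟨κ, _, R, hR, ⟨eK⟩⟩ := exists_equiv_pi_zmod g.ker
    have hcard : ∀ m, #{x | cyclicOrders q k₀ k x = m} = #{i | Q i = m} + #{j | R j = m} := by
      intro m
      rw [card_filter_eq_of_pi_zmod_equiv (R := Sum.elim Q R)
        (cyclicOrders_eq_zero_or_isPrimePow hq k₀ k) (by rintro (i | j); exacts [hQ i, hR j])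
        ((prodPiEquivPiCyclicOrders q k₀ k).symm.trans (E.trans ((eH.prodCongr eK).trans
          (LinearEquiv.sumPiEquivProdPi ℤ _ _ fun x =>
            ZMod (Sum.elim Q R x)).symm.toAddEquiv))) m]
      simp only [card_filter, Fintype.sum_sum_type]
      rfl
    refine ⟨#{i | Q i = 0}, fun i => #{j | Q j = q i}, ?_, fun i => ?_, ?_⟩
    · have := hcard 0
      rw [card_cyclicOrders_zero hq] at this
      omega
    · have := hcard (q i)
      rw [card_cyclicOrders_apply hq hq'] at this
      dsimp only
      omega
    · obtain ⟨e⟩ := nonempty_pi_zmod_equiv_of_card_filter_eq (Q := Q)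
        (R := cyclicOrders q #{i | Q i = 0} fun i => #{j | Q j = q i}) fun m => by
          by_cases hm₀ : m = 0
          · rw [hm₀, card_cyclicOrders_zero hq]
          by_cases hm : m ∈ Set.range q
          · obtain ⟨i, rfl⟩ := hm
            rw [card_cyclicOrders_apply hq hq']
          · have := hcard m
            rw [card_cyclicOrders_of_notMem hm₀ hm] at this ⊢
            omega
      exact ⟨eH.trans (e.trans (prodPiEquivPiCyclicOrders q _ _).symm)⟩
  · rintro ⟨t₀, t, ht₀, ht, ⟨e⟩⟩
    obtain ⟨g₀, f₀, h₀⟩ := exists_retraction_pi_fin ℤ ht₀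
    choose g f h using fun i => exists_retraction_pi_fin (ZMod (q i)) (ht i)
    refine AddGrpDominated.of_equiv e
      (g := g₀.prodMap (AddMonoidHom.pi fun i => (g i).comp (Pi.evalAddMonoidHom _ i)))
      (f := f₀.prodMap (AddMonoidHom.pi fun i => (f i).comp (Pi.evalAddMonoidHom _ i)))
      fun x => Prod.ext (h₀ _) (funext fun i => h i _)
  · have hcard := card_filter_eq_of_pi_zmod_equiv (cyclicOrders_eq_zero_or_isPrimePow hq t₀ t)
      (cyclicOrders_eq_zero_or_isPrimePow hq t₀' t')
      ((prodPiEquivPiCyclicOrders q t₀ t).symm.trans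
        (e.trans (prodPiEquivPiCyclicOrders q t₀' t')))
    refine ⟨by simpa only [card_cyclicOrders_zero hq] using hcard 0, funext fun i => ?_⟩
    simpa only [card_cyclicOrders_apply hq hq'] using hcard (q i)
end

section
/- Let q_1, …, q_n be pairwise distinct prime powers, let k_0, k_1, …, k_n be natural numbers, and let G = ℤ^{k_0} × (ℤ/q_1)^{k_1} × ⋯ × (ℤ/q_n)^{k_n}. Then the depth and the strong depth of G equal (k_0 + k_1 + ⋯ + k_n) + 1: there exists an s-chain of length (∑ k_i) + 1 for G, and there is no chain of length (∑ k_i) + 2 for G. -/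
universe u v

/-- `H ≤ᵈ G` in the category of groups (additive notation), with explicitly given
group structures. -/
def AddGrpDominatedI (H : Type u) (G : Type v) (iH : AddGroup H) (iG : AddGroup G) : Prop :=
  letI := iH; letI := iG
  ∃ (g : G →+ H) (f : H →+ G), ∀ h, g (f h) = h

/-- `H` and `G` are isomorphic groups, with explicitly given group structures. -/
def AddGrpIsoI (H : Type u) (G : Type v) (iH : AddGroup H) (iG : AddGroup G) : Prop :=
  letI := iH; letI := iG
  Nonempty (H ≃+ G)

/-- `H <ˢ G`: strong domination. -/
def AddGrpSDomI (H : Type u) (G : Type v) (iH : AddGroup H) (iG : AddGroup G) : Prop :=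
  AddGrpDominatedI H G iH iG ∧ ¬ AddGrpDominatedI G H iG iH

/-- `H <ᵖ G`: proper domination. -/
def AddGrpPDomI (H : Type u) (G : Type v) (iH : AddGroup H) (iG : AddGroup G) : Prop :=
  AddGrpDominatedI H G iH iG ∧ ¬ AddGrpIsoI H G iH iG

open UniqueFactorizationMonoid in
/-- For a prime power `q` dividing `m`, the elements of `ZMod q` killed by the radical of `m` form
a group of length one. -/
theorem length_torsionBy_radical_zmod {q m : ℕ} (hq : IsPrimePow q) (hm : m ≠ 0) (hqm : q ∣ m) :
    Module.length ℤ (Submodule.torsionBy ℤ (ZMod q) (radical m : ℕ)) = 1 := by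
  have hq1 := hq.one_lt
  have : NeZero q := ⟨by omega⟩
  obtain ⟨p, e, hp, he, rfl⟩ := (isPrimePow_nat_iff q).1 hq
  have hgcd : (p ^ e).gcd (radical m) = p := by
    have hpr : p ∣ radical m :=
      (dvd_radical_iff_of_irreducible hp hm).2 ((dvd_pow_self p he.ne').trans hqm)
    obtain ⟨i, hi, h⟩ := (Nat.dvd_prime_pow hp).1 (Nat.gcd_dvd_left (p ^ e) (radical m))
    have hsq : Squarefree (p ^ i) :=
      squarefree_radical.squarefree_of_dvd (h ▸ Nat.gcd_dvd_right _ _)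
    have hpd : p ∣ p ^ i := h ▸ Nat.dvd_gcd (dvd_pow_self p he.ne') hpr
    have hi0 : i ≠ 0 := by
      rintro rfl
      exact hp.one_lt.ne' (Nat.dvd_one.1 (by simpa using hpd))
    rw [h]
    rcases (Nat.squarefree_pow_iff hp.ne_one hi0).1 hsq with ⟨-, rfl⟩
    simp
  set T := Submodule.torsionBy ℤ (ZMod (p ^ e)) (radical m : ℕ)
  have hcard : Nat.card T = p := by
    have h := IsAddCyclic.card_nsmulAddMonoidHom_ker (ZMod (p ^ e)) (radical m)
    rw [Nat.card_zmod, hgcd] at h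
    refine (Nat.card_congr (Equiv.subtypeEquivRight fun x => ?_)).trans h
    simp [T, Submodule.mem_torsionBy_iff, AddMonoidHom.mem_ker]
  have := Fact.mk hp
  have : IsSimpleAddGroup T := isSimpleAddGroup_of_prime_card hcard
  rw [Module.length_eq_one_iff, isSimpleModule_iff]
  exact
    { exists_pair_ne := exists_pair_ne _
      eq_bot_or_eq_top := fun H => by
        rcases IsSimpleAddGroup.eq_bot_or_eq_top_of_normal H.toAddSubgroup inferInstance with h | h
        · exact Or.inl (Submodule.toAddSubgroup_injective h)
        · exact Or.inr (Submodule.toAddSubgroup_injective h) }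

/-- The rank of a submodule plus the length of its `r`-torsion. -/
noncomputable def rankAddTorsionLength {G : Type*} [AddCommGroup G] (r : ℤ)
    (S : Submodule ℤ G) : ℕ∞ :=
  (Module.finrank ℤ S : ℕ∞) + Order.height (S ⊓ Submodule.torsionBy ℤ G r)

theorem eq_zero_of_pow_smul_eq_zero {G : Type*} [AddCommGroup G] {r : ℤ} {K : Submodule ℤ G}
    (hK : K ⊓ Submodule.torsionBy ℤ G r = ⊥) (j : ℕ) {x : G} (hx : x ∈ K)
    (h : r ^ j • x = 0) : x = 0 := by
  induction j with
  | zero => simpa using h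
  | succ j ih =>
    refine ih ?_
    have hmem : r ^ j • x ∈ K ⊓ Submodule.torsionBy ℤ G r := by
      refine ⟨K.smul_mem _ hx, ?_⟩
      rw [SetLike.mem_coe, Submodule.mem_torsionBy_iff, smul_smul, ← pow_succ', h]
    simpa [hK] using hmem

/-- The invariant strictly decreases along proper retracts. -/
theorem rankAddTorsionLength_lt {G : Type*} [AddCommGroup G] [Module.Finite ℤ G] {r : ℤ} {j : ℕ}
    (htors : ∀ x : G, ∀ a : ℤ, a ≠ 0 → a • x = 0 → r ^ j • x = 0)
    (hfin : Module.length ℤ (Submodule.torsionBy ℤ G r) < ⊤)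
    {S S' : Submodule ℤ G} (hlt : S' < S) (e : G →ₗ[ℤ] G) (heS : ∀ x, e x ∈ S')
    (he : ∀ x ∈ S', e x = x) :
    rankAddTorsionLength r S' < rankAddTorsionLength r S := by
  set T := Submodule.torsionBy ℤ G r
  have hheight : ∀ U : Submodule ℤ G, Order.height (U ⊓ T) < ⊤ := fun U =>
    (Order.height_mono inf_le_right).trans_lt (Module.length_submodule (R := ℤ) (N := T) ▸ hfin)
  have hle : S' ⊓ T ≤ S ⊓ T := inf_le_inf_right _ hlt.le
  have hrank : Module.finrank ℤ S' ≤ Module.finrank ℤ S := Submodule.finrank_mono hlt.le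
  unfold rankAddTorsionLength
  rcases hle.lt_or_eq with hT | hT
  · exact ENat.add_lt_add_of_le_of_lt (ENat.natCast_ne_top _) (by exact_mod_cast hrank)
      (Order.height_strictMono hT (hheight _))
  · rcases hrank.lt_or_eq with hr | hr
    · rw [show S' ⊓ Submodule.torsionBy ℤ G r = S ⊓ Submodule.torsionBy ℤ G r from hT]
      exact ENat.add_lt_add_of_lt_of_le (hheight _).ne (by exact_mod_cast hr) le_rfl
    · exfalso
      refine hlt.not_ge fun x hx => ?_
      have hrange : LinearMap.range (e.domRestrict S) = S' := by
        ext y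
        constructor
        · rintro ⟨z, rfl⟩
          exact heS _
        · exact fun hy => ⟨⟨y, hlt.le hy⟩, he y hy⟩
      have hrn := Submodule.finrank_quotient_add_finrank (LinearMap.ker (e.domRestrict S))
      rw [(e.domRestrict S).quotKerEquivRange.finrank_eq, hrange, hr] at hrn
      have hker : Module.finrank ℤ (LinearMap.ker (e.domRestrict S)) = 0 := by omega
      rw [Module.finrank_eq_zero_iff] at hker
      have hK : (S ⊓ LinearMap.ker e) ⊓ Submodule.torsionBy ℤ G r = ⊥ := by
        rw [eq_bot_iff]
        rintro y ⟨⟨hyS, hye⟩, hyT⟩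
        have hy' : y ∈ S' ⊓ T := hT ▸ ⟨hyS, hyT⟩
        rw [Submodule.mem_bot, ← he y hy'.1]
        exact hye
      have hmem : x - e x ∈ S ⊓ LinearMap.ker e := by
        refine ⟨S.sub_mem hx (hlt.le (heS x)), ?_⟩
        rw [SetLike.mem_coe, LinearMap.mem_ker, map_sub, he _ (heS x), sub_self]
      obtain ⟨a, ha, hax⟩ := hker ⟨⟨x - e x, hmem.1⟩, hmem.2⟩
      have hax' : a • (x - e x) = 0 := congrArg Subtype.val (congrArg Subtype.val hax)
      have h0 := eq_zero_of_pow_smul_eq_zero hK j hmem (htors _ a ha hax')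
      rw [sub_eq_zero] at h0
      exact h0 ▸ heS x

/-- If `rankAddTorsionLength` of the whole group is at most `L`, no chain has length `L + 2`. -/
theorem not_exists_chain {G : Type v} [AddCommGroup G] [Module.Finite ℤ G] {r : ℤ} {j L : ℕ}
    (htors : ∀ x : G, ∀ a : ℤ, a ≠ 0 → a • x = 0 → r ^ j • x = 0)
    (hfin : Module.length ℤ (Submodule.torsionBy ℤ G r) < ⊤)
    (hL : rankAddTorsionLength r (⊤ : Submodule ℤ G) ≤ L)
    (X : ℕ → Type u) (inst : ∀ m, AddGroup (X m))
    (h1 : AddGrpDominatedI (X 1) G (inst 1) inferInstance)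
    (hstep : ∀ i, 1 ≤ i → i ≤ L + 1 →
      AddGrpPDomI (X (i + 1)) (X i) (inst (i + 1)) (inst i)) : False := by
  have key : ∀ i, i ≤ L + 1 → ∃ (g : G →+ X (i + 1)) (f : X (i + 1) →+ G),
      (∀ h, g (f h) = h) ∧
      rankAddTorsionLength r (AddSubgroup.toIntSubmodule f.range) + i ≤ L := by
    intro i
    induction i with
    | zero =>
      intro _
      obtain ⟨g, f, hgf⟩ := h1
      refine ⟨g, f, hgf, le_trans ?_ hL⟩
      simp only [Nat.cast_zero, add_zero]
      exact add_le_add (by exact_mod_cast Submodule.finrank_mono le_top)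
        (Order.height_mono (inf_le_inf_right _ le_top))
    | succ i ih =>
      intro hi
      obtain ⟨g, f, hgf, hS⟩ := ih (by omega)
      obtain ⟨⟨g', f', hgf'⟩, hiso⟩ := hstep (i + 1) (by omega) hi
      refine ⟨g'.comp g, f.comp f', fun h => by simp [hgf, hgf'], ?_⟩
      have hlt : AddSubgroup.toIntSubmodule (f.comp f').range <
          AddSubgroup.toIntSubmodule f.range := by
        rw [OrderIso.lt_iff_lt]
        refine lt_of_le_of_ne ?_ fun heq => hiso ?_
        · rintro _ ⟨y, rfl⟩
          exact ⟨f' y, rfl⟩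
        · refine ⟨AddEquiv.ofBijective f'
            ⟨Function.LeftInverse.injective hgf', fun y => ?_⟩⟩
          have hy : f y ∈ (f.comp f').range := heq ▸ ⟨y, rfl⟩
          obtain ⟨z, hz⟩ := hy
          exact ⟨z, Function.LeftInverse.injective hgf hz⟩
      have hdec := rankAddTorsionLength_lt htors hfin hlt
        ((f.comp f').comp (g'.comp g)).toIntLinearMap
        (fun x => ⟨_, rfl⟩) (by rintro _ ⟨y, rfl⟩; simp [hgf, hgf'])
      refine le_trans ?_ hS
      have := Order.add_one_le_of_lt hdec
      calc _ = (rankAddTorsionLength r (AddSubgroup.toIntSubmodule (f.comp f').range) + 1) + i := by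
            push_cast; ring
        _ ≤ _ := by gcongr
  obtain ⟨g, f, -, h⟩ := key (L + 1) le_rfl
  have h' : ((L + 1 : ℕ) : ℕ∞) ≤ L := le_trans le_add_self h
  have : L + 1 ≤ L := by exact_mod_cast h'
  omega

open UniqueFactorizationMonoid in
theorem length_torsionBy_radical_prod_le {n : ℕ} {q : Fin n → ℕ} (hq : ∀ i, IsPrimePow (q i))
    (k₀ : ℕ) (k : Fin n → ℕ) :
    Module.length ℤ (Submodule.torsionBy ℤ
      ((Fin k₀ → ℤ) × ((i : Fin n) → Fin (k i) → ZMod (q i))) (radical (∏ i, q i) : ℕ)) ≤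
      ((∑ i, k i : ℕ) : ℕ∞) := by
  set r : ℤ := ((radical (∏ i, q i) : ℕ) : ℤ) with hr
  have hr0 : r ≠ 0 := by
    rw [hr]
    exact_mod_cast radical_ne_zero
  let φ : Submodule.torsionBy ℤ ((Fin k₀ → ℤ) × ((i : Fin n) → Fin (k i) → ZMod (q i))) r →ₗ[ℤ]
      ((i : Fin n) → Fin (k i) → Submodule.torsionBy ℤ (ZMod (q i)) r) :=
    { toFun := fun x i a => ⟨x.1.2 i a, by
        have h := (Submodule.mem_torsionBy_iff _ _).1 x.2
        rw [Submodule.mem_torsionBy_iff]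
        exact congrFun (congrFun (congrArg Prod.snd h) i) a⟩
      map_add' := fun x y => rfl
      map_smul' := fun c x => rfl }
  have hφ : Function.Injective φ := by
    rw [injective_iff_map_eq_zero]
    rintro ⟨⟨x, y⟩, hxy⟩ h
    have hx : r • x = 0 := congrArg Prod.fst ((Submodule.mem_torsionBy_iff _ _).1 hxy)
    have hx0 : x = 0 := (smul_eq_zero.1 hx).resolve_left hr0
    have hy0 : y = 0 := by
      funext i a
      exact congrArg Subtype.val (congrFun (congrFun h i) a)
    subst hx0 hy0
    rfl
  refine (Module.length_le_of_injective φ hφ).trans_eq ?_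
  rw [Module.length_pi_of_fintype]
  push_cast
  refine Finset.sum_congr rfl fun i _ => ?_
  rw [Module.length_pi, length_torsionBy_radical_zmod (hq i)
    (Finset.prod_ne_zero_iff.2 fun i _ => (hq i).ne_zero)
    (Finset.dvd_prod_of_mem q (Finset.mem_univ i))]
  simp

theorem finrank_prod_zmod_le {n : ℕ} {q : Fin n → ℕ} (hq : ∀ i, q i ≠ 0)
    (k₀ : ℕ) (k : Fin n → ℕ) :
    Module.finrank ℤ ((Fin k₀ → ℤ) × ((i : Fin n) → Fin (k i) → ZMod (q i))) ≤ k₀ := by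
  have : ∀ i, NeZero (q i) := fun i => ⟨hq i⟩
  let p := LinearMap.fst ℤ (Fin k₀ → ℤ) ((i : Fin n) → Fin (k i) → ZMod (q i))
  have h := Submodule.finrank_quotient_add_finrank (LinearMap.ker p)
  have h0 : Module.finrank ℤ (LinearMap.ker p) = 0 := by
    rw [Module.finrank_eq_zero_iff]
    rintro ⟨⟨x, y⟩, hx⟩
    refine ⟨((∏ i, q i : ℕ) : ℤ), ?_, ?_⟩
    · exact_mod_cast Finset.prod_ne_zero_iff.2 fun i _ => hq i
    · have hx0 : x = 0 := hx
      subst hx0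
      refine Subtype.ext (Prod.ext
        (smul_zero ((∏ i, q i : ℕ) : ℤ) : _ • (0 : Fin k₀ → ℤ) = 0) ?_)
      funext i a
      change ((∏ i, q i : ℕ) : ℤ) • y i a = 0
      have : ((∏ i, q i : ℕ) : ZMod (q i)) = 0 :=
        (ZMod.natCast_eq_zero_iff _ _).2 (Finset.dvd_prod_of_mem q (Finset.mem_univ i))
      rw [zsmul_eq_mul, Int.cast_natCast, this, zero_mul]
  rw [p.quotKerEquivRange.finrank_eq, h0, add_zero] at h
  rw [← h]
  exact (Submodule.finrank_le _).trans_eq (by simp)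

open UniqueFactorizationMonoid in
theorem radical_pow_smul_eq_zero {n : ℕ} {q : Fin n → ℕ} (hq : ∀ i, q i ≠ 0)
    {k₀ : ℕ} {k : Fin n → ℕ} (x : (Fin k₀ → ℤ) × ((i : Fin n) → Fin (k i) → ZMod (q i)))
    (a : ℤ) (ha : a ≠ 0) (hax : a • x = 0) :
    (((radical (∏ i, q i) : ℕ) : ℤ)) ^ (∏ i, q i) • x = 0 := by
  have hx1 : x.1 = 0 := (smul_eq_zero.1 (congrArg Prod.fst hax)).resolve_left ha
  refine Prod.ext ?_ ?_
  · rw [Prod.smul_fst, hx1, smul_zero, Prod.fst_zero]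
  · funext i b
    change (((radical (∏ i, q i) : ℕ) : ℤ)) ^ (∏ i, q i) • x.2 i b = 0
    have : ((radical (∏ i, q i) ^ (∏ i, q i) : ℕ) : ZMod (q i)) = 0 :=
      (ZMod.natCast_eq_zero_iff _ _).2 ((Finset.dvd_prod_of_mem q (Finset.mem_univ i)).trans
        (Nat.dvd_radical_pow_self (Finset.prod_ne_zero_iff.2 fun i _ => hq i)))
    rw [← Nat.cast_pow, zsmul_eq_mul, Int.cast_natCast, this, zero_mul]

instance ZMod.moduleFinite_int (m : ℕ) : Module.Finite ℤ (ZMod m) :=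
  Module.Finite.of_surjective (Int.castAddHom (ZMod m)).toIntLinearMap ZMod.intCast_surjective

/-- Restricting a finite product of nontrivial cyclic groups to a proper set of coordinates
gives a strictly dominated group. -/
theorem addGrpSDomI_pi_zmod {I : Type} [Finite I] {r : I → ℕ} {P Q : I → Prop}
    (hPQ : ∀ a, P a → Q a) {b : I} (hb : Q b) (hb' : ¬ P b) (hr : r b ≠ 1) :
    AddGrpSDomI ((a : {a // P a}) → ZMod (r a)) ((a : {a // Q a}) → ZMod (r a))
      inferInstance inferInstance := by
  classical
  let p : ((a : {a // Q a}) → ZMod (r a)) →+ ((a : {a // P a}) → ZMod (r a)) :=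
    { toFun := fun x a => x ⟨a, hPQ a a.2⟩
      map_zero' := rfl
      map_add' := fun x y => rfl }
  let f : ((a : {a // P a}) → ZMod (r a)) →+ ((a : {a // Q a}) → ZMod (r a)) :=
    { toFun := fun x a => if h : P a then x ⟨a, h⟩ else 0
      map_zero' := by funext a; simp
      map_add' := fun x y => by funext a; by_cases h : P a <;> simp [h] }
  have hpf : ∀ x, p (f x) = x := fun x => by
    funext a
    simp [p, f, a.2]
  refine ⟨⟨p, f, hpf⟩, ?_⟩
  rintro ⟨g, f', hg⟩
  have hinj := IsNoetherian.injective_of_surjective_endomorphism (g.comp p).toIntLinearMap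
    ((Function.LeftInverse.surjective (g := f') hg).comp
      (Function.LeftInverse.surjective (g := f) hpf))
  have : Nontrivial (ZMod (r b)) := ZMod.nontrivial_iff.2 hr
  have h0 : p (Pi.single ⟨b, hb⟩ 1) = 0 := by
    funext a
    refine Pi.single_eq_of_ne (fun h => hb' ?_) _
    have : (a : I) = b := congrArg Subtype.val h
    exact this ▸ a.2
  have h1 : (Pi.single ⟨b, hb⟩ 1 : (a : {a // Q a}) → ZMod (r a)) = 0 :=
    hinj (by simp [h0])
  have h2 := congrFun h1 ⟨b, hb⟩
  simp at h2

/-- A finite product of nontrivial cyclic groups admits an s-chain obtained by dropping one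
coordinate at a time. -/
theorem exists_sChain {I : Type} [Fintype I] {r : I → ℕ} (hr : ∀ a, r a ≠ 1) {L : ℕ}
    (hL : Fintype.card I = L) :
    ∃ (P : ℕ → I → Prop), (∀ a, P 1 a) ∧ ∀ i, 1 ≤ i → i ≤ L →
      AddGrpSDomI ((a : {a // P (i + 1) a}) → ZMod (r a)) ((a : {a // P i a}) → ZMod (r a))
        inferInstance inferInstance := by
  let e := Fintype.equivFinOfCardEq hL
  refine ⟨fun m a => (e a : ℕ) + m ≤ L, fun a => (e a).2, fun i hi hiL => ?_⟩
  refine addGrpSDomI_pi_zmod (b := e.symm ⟨L - i, by omega⟩) (fun a h => by omega) ?_ ?_ (hr _)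
  · simp; omega
  · simp; omega

/-- The depth and the strong depth of `G = ℤ^{k₀} × (ℤ/q₁)^{k₁} × ⋯ × (ℤ/qₙ)^{kₙ}` (the
`qᵢ` pairwise distinct prime powers) equal `(k₀ + k₁ + ⋯ + kₙ) + 1`: there is an s-chain
of that length for `G` and no chain of length `(k₀ + k₁ + ⋯ + kₙ) + 2`. -/
theorem depth_of_fg_abelian (n : ℕ) (q : Fin n → ℕ)
    (hq : ∀ i, IsPrimePow (q i)) (hq' : Function.Injective q)
    (k₀ : ℕ) (k : Fin n → ℕ) :
    (∃ (X : ℕ → Type) (inst : ∀ m, AddGroup (X m)),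
      AddGrpDominatedI (X 1) ((Fin k₀ → ℤ) × ((i : Fin n) → Fin (k i) → ZMod (q i)))
        (inst 1) inferInstance ∧
      ∀ i, 1 ≤ i → i ≤ k₀ + ∑ j, k j →
        AddGrpSDomI (X (i + 1)) (X i) (inst (i + 1)) (inst i)) ∧
    (∀ (X : ℕ → Type u) (inst : ∀ m, AddGroup (X m)),
      ¬ (AddGrpDominatedI (X 1) ((Fin k₀ → ℤ) × ((i : Fin n) → Fin (k i) → ZMod (q i)))
          (inst 1) inferInstance ∧
        ∀ i, 1 ≤ i → i ≤ (k₀ + ∑ j, k j) + 1 →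
          AddGrpPDomI (X (i + 1)) (X i) (inst (i + 1)) (inst i))) := by
  have hq0 : ∀ i, q i ≠ 0 := fun i => (hq i).ne_zero
  refine ⟨?_, fun X inst hX => ?_⟩
  · let r : Fin k₀ ⊕ (Σ i, Fin (k i)) → ℕ := Sum.elim (fun _ => 0) fun s => q s.1
    have hr : ∀ a, r a ≠ 1 := by
      rintro (a | s)
      · exact zero_ne_one
      · exact (hq s.1).ne_one
    obtain ⟨P, hP, hchain⟩ := exists_sChain hr (L := k₀ + ∑ j, k j) (by simp)
    refine ⟨fun m => (a : {a // P m a}) → ZMod (r a), fun m => inferInstance, ?_, hchain⟩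
    refine ⟨
      { toFun := fun x a => match a with
          | ⟨Sum.inl a, _⟩ => x.1 a
          | ⟨Sum.inr s, _⟩ => x.2 s.1 s.2
        map_zero' := by funext a; rcases a with ⟨a | s, h⟩ <;> rfl
        map_add' := fun x y => by funext a; rcases a with ⟨a | s, h⟩ <;> rfl },
      { toFun := fun y => (fun a => y ⟨Sum.inl a, hP _⟩, fun i b => y ⟨Sum.inr ⟨i, b⟩, hP _⟩)
        map_zero' := rfl
        map_add' := fun x y => rfl }, fun y => ?_⟩
    funext a
    rcases a with ⟨a | s, h⟩ <;> rfl
  · have hlen := length_torsionBy_radical_prod_le hq k₀ k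
    refine not_exists_chain (radical_pow_smul_eq_zero hq0)
      (hlen.trans_lt (ENat.natCast_lt_top _)) (L := k₀ + ∑ j, k j) ?_ X inst hX.1 hX.2
    rw [rankAddTorsionLength, top_inf_eq, ← Module.length_submodule, finrank_top]
    push_cast
    refine add_le_add (by exact_mod_cast finrank_prod_zmod_le hq0 k₀ k) ?_
    exact_mod_cast hlen
end

section
/- Let G be a virtually polycyclic group, i.e., G has a subgroup of finite index that is solvable and satisfies the maximal condition on subgroups (every subgroup of it is finitely generated). Then the depth of G is finite: there exists a natural number k such that there is no chain of length k+1 for G, i.e., no groups H_1, …, H_{k+1} with H_{k+1} <^p H_k <^p ⋯ <^p H_1 ≤^d G. -/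
universe u v

/-- `H ≤ᵈ G` in the category of groups, with explicitly given group structures. -/
def GrpDominatedI (H : Type u) (G : Type v) (iH : Group H) (iG : Group G) : Prop :=
  letI := iH; letI := iG
  ∃ (g : G →* H) (f : H →* G), ∀ h, g (f h) = h

/-- `H` and `G` are isomorphic groups, with explicitly given group structures. -/
def GrpIsoI (H : Type u) (G : Type v) (iH : Group H) (iG : Group G) : Prop :=
  letI := iH; letI := iG
  Nonempty (H ≃* G)

/-- `H <ᵖ G`: proper domination. -/
def GrpPDomI (H : Type u) (G : Type v) (iH : Group H) (iG : Group G) : Prop :=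
  GrpDominatedI H G iH iG ∧ ¬ GrpIsoI H G iH iG

/-- A group is virtually polycyclic if it has a finite-index subgroup which is solvable
and all of whose subgroups are finitely generated. -/
def IsVirtuallyPolycyclic (G : Type v) [Group G] : Prop :=
  ∃ K : Subgroup G, K.FiniteIndex ∧ IsSolvable K ∧ ∀ L : Subgroup K, L.FG

/-- A group with a monotone rank on its subgroups that drops along subgroups of infinite index,
and with a bound on the orders of its finite subgroups. -/
structure IsRankBounded (G : Type*) [Group G] : Prop where
  exists_rank : ∃ r : Subgroup G → ℕ, ∀ A B, A ≤ B → r A ≤ r B ∧ (A.relIndex B = 0 → r A < r B)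
  exists_card_bound : ∃ m : ℕ, ∀ F : Subgroup G, Finite F → Nat.card F ≤ m

theorem AddSubgroup.finrank_lt_of_relIndex_eq_zero {M : Type*} [AddCommGroup M]
    [Module.Finite ℤ M] {A B : AddSubgroup M} (hAB : A ≤ B) (h : A.relIndex B = 0) :
    Module.finrank ℤ A.toIntSubmodule < Module.finrank ℤ B.toIntSubmodule := by
  have key := (A.toIntSubmodule.comap B.toIntSubmodule.subtype).finrank_quotient_add_finrank
  rw [(Submodule.comapSubtypeEquivOfLe (p := A.toIntSubmodule) (q := B.toIntSubmodule)
    hAB).finrank_eq] at key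
  rw [← key]
  refine Nat.lt_add_of_pos_left (Nat.pos_of_ne_zero fun h0 ↦ ?_)
  have hfin := Module.finite_of_fg_torsion _ (Module.finrank_eq_zero_iff_isTorsion.mp h0)
  have : Finite (B ⧸ A.addSubgroupOf B) := hfin
  exact AddSubgroup.index_ne_zero_of_finite h

theorem isRankBounded_of_commGroup_fg (Q : Type*) [CommGroup Q] [Group.FG Q] :
    IsRankBounded Q := by
  have : Module.Finite ℤ (Additive Q) := Module.Finite.iff_addGroup_fg.mpr inferInstance
  refine ⟨⟨fun A ↦ Module.finrank ℤ A.toAddSubgroup.toIntSubmodule, fun A B hAB ↦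
    ⟨Submodule.finrank_mono hAB, AddSubgroup.finrank_lt_of_relIndex_eq_zero (A := A.toAddSubgroup)
      (B := B.toAddSubgroup) hAB⟩⟩, ?_⟩
  have hfin : Finite (Submodule.torsion ℤ (Additive Q)) :=
    Module.finite_of_fg_torsion _ (Submodule.torsion_isTorsion)
  refine ⟨Nat.card (Submodule.torsion ℤ (Additive Q)), fun F hF ↦ ?_⟩
  refine Nat.card_le_card_of_injective
    (fun x : F ↦ (⟨Additive.ofMul x.1, ?_⟩ : Submodule.torsion ℤ (Additive Q)))
    fun x y hxy ↦ Subtype.ext (congrArg (fun z ↦ z.1.toMul) hxy)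
  refine (Submodule.mem_torsion_iff _).mpr ⟨⟨(Nat.card F : ℤ), mem_nonZeroDivisors_of_ne_zero
    (by exact_mod_cast Nat.card_pos.ne')⟩, ?_⟩
  have hx : x.1 ^ Nat.card F = 1 := by
    exact_mod_cast congrArg Subtype.val (pow_card_eq_one' (x := x))
  change ((Nat.card F : ℤ)) • Additive.ofMul x.1 = 0
  rw [natCast_zsmul, ← ofMul_pow, hx, ofMul_one]

namespace Subgroup

variable {G N Q : Type*} [Group G] [Group N] [Group Q]

theorem relIndex_sup_right_of_normal_right (A K : Subgroup G) [K.Normal] :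
    A.relIndex (A ⊔ K) = A.relIndex K := by
  refine (Nat.card_congr (Equiv.ofBijective
    (quotientSubgroupOfEmbeddingOfLE A (le_sup_right : K ≤ A ⊔ K))
    ⟨(quotientSubgroupOfEmbeddingOfLE A _).injective, fun q ↦ ?_⟩)).symm
  induction q using QuotientGroup.induction_on with
  | H x =>
    obtain ⟨x, hx⟩ := x
    obtain ⟨k, hk, a, ha, rfl⟩ : ∃ k ∈ K, ∃ a ∈ A, k * a = x := by
      rwa [← SetLike.mem_coe, sup_comm, normal_mul] at hx
    refine ⟨QuotientGroup.mk ⟨k, hk⟩, ?_⟩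
    rw [quotientSubgroupOfEmbeddingOfLE_apply_mk, QuotientGroup.eq, mem_subgroupOf]
    simpa using ha

theorem index_eq_relIndex_ker_mul (A : Subgroup G) (f : G →* Q) :
    A.index = A.relIndex f.ker * (A.map f).relIndex f.range := by
  rw [← relIndex_mul_index (le_sup_left : A ≤ A ⊔ f.ker), relIndex_sup_right_of_normal_right,
    ← comap_map_eq, index_comap]

theorem relIndex_eq_relIndex_ker_mul {A B : Subgroup G} (hAB : A ≤ B) (f : G →* Q) :
    A.relIndex B = A.relIndex (B ⊓ f.ker) * (A.map f).relIndex (B.map f) := by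
  have := index_eq_relIndex_ker_mul (A.subgroupOf B) (f.comp B.subtype)
  rw [← map_map, map_subgroupOf_eq_of_le hAB, MonoidHom.range_comp, range_subtype,
    subgroupOf, relIndex_comap, ← MonoidHom.comap_ker, map_comap_eq, range_subtype] at this
  exact this

theorem card_eq_card_inf_mul_relIndex (F R : Subgroup G) :
    Nat.card F = Nat.card (R ⊓ F : Subgroup G) * R.relIndex F := by
  rw [← relIndex_bot_left, ← relIndex_bot_left, ← inf_relIndex_right R F,
    relIndex_mul_relIndex _ _ _ bot_le inf_le_right]

theorem card_comap_of_injective {i : N →* G} (hi : Function.Injective i) (F : Subgroup G) :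
    Nat.card (F.comap i) = Nat.card (i.range ⊓ F : Subgroup G) := by
  rw [← map_comap_eq, card_map_of_injective hi]

theorem finite_comap_of_injective {i : N →* G} (hi : Function.Injective i) (F : Subgroup G)
    [Finite F] : Finite (F.comap i) :=
  Finite.of_injective (fun x : F.comap i ↦ (⟨i x, x.2⟩ : F))
    fun _ _ h ↦ Subtype.ext (hi (congrArg Subtype.val h))

end Subgroup

namespace IsRankBounded

variable {G N Q : Type*} [Group G] [Group N] [Group Q]

theorem of_exact (hN : IsRankBounded N) (hQ : IsRankBounded Q) {i : N →* G}
    (hi : Function.Injective i) (f : G →* Q) (hif : i.range = f.ker) : IsRankBounded G := by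
  obtain ⟨⟨r, hr⟩, m, hm⟩ := hN
  obtain ⟨⟨s, hs⟩, n, hn⟩ := hQ
  refine ⟨⟨fun A ↦ r (A.comap i) + s (A.map f), fun A B hAB ↦ ?_⟩, m * n, fun F hF ↦ ?_⟩
  · obtain ⟨hr₁, hr₂⟩ := hr _ _ (Subgroup.comap_mono (f := i) hAB)
    obtain ⟨hs₁, hs₂⟩ := hs _ _ (Subgroup.map_mono (f := f) hAB)
    refine ⟨add_le_add hr₁ hs₁, fun h ↦ ?_⟩
    rw [Subgroup.relIndex_comap, Subgroup.map_comap_eq, hif, inf_comm] at hr₂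
    rw [Subgroup.relIndex_eq_relIndex_ker_mul hAB f, mul_eq_zero] at h
    rcases h with h | h
    · exact add_lt_add_of_lt_of_le (hr₂ h) hs₁
    · exact add_lt_add_of_le_of_lt hr₁ (hs₂ h)
  · rw [Subgroup.card_eq_card_inf_mul_relIndex F f.ker, Subgroup.relIndex_ker, ← hif,
      ← Subgroup.card_comap_of_injective hi]
    exact Nat.mul_le_mul (hm _ (Subgroup.finite_comap_of_injective hi F))
      (hn _ (Finite.of_surjective _ (f.subgroupMap_surjective F)))

theorem of_finiteIndex {K : Subgroup G} (hK : IsRankBounded K) (hi : K.FiniteIndex) :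
    IsRankBounded G := by
  obtain ⟨⟨r, hr⟩, m, hm⟩ := hK
  refine ⟨⟨fun A ↦ r (A.subgroupOf K), fun A B hAB ↦ ?_⟩, m * K.index, fun F hF ↦ ?_⟩
  · obtain ⟨hr₁, hr₂⟩ := hr _ _ (Subgroup.comap_mono (f := K.subtype) hAB)
    refine ⟨hr₁, fun h ↦ hr₂ ?_⟩
    rw [Subgroup.relIndex_comap, Subgroup.map_comap_eq, Subgroup.range_subtype]
    by_contra h'
    refine Subgroup.relIndex_ne_zero_trans h' ?_ h
    rw [Subgroup.inf_relIndex_right]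
    exact fun h₀ ↦ hi.index_ne_zero (Subgroup.index_eq_zero_of_relIndex_eq_zero h₀)
  · have hinj := K.subtype_injective
    rw [Subgroup.card_eq_card_inf_mul_relIndex F K]
    nth_rw 1 [← K.range_subtype]
    rw [← Subgroup.card_comap_of_injective hinj]
    refine Nat.mul_le_mul (hm _ (Subgroup.finite_comap_of_injective hinj F)) ?_
    rw [← Subgroup.relIndex_top_right]
    exact Subgroup.relIndex_le_of_le_right le_top
      (by rw [Subgroup.relIndex_top_right]; exact hi.index_ne_zero)

theorem of_isSolvable [Group.IsSolvable G] (hfg : ∀ L : Subgroup G, L.FG) : IsRankBounded G := by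
  obtain ⟨n, hn⟩ := (Group.isSolvable_def G).mp ‹_›
  have key : ∀ j ≤ n, IsRankBounded (derivedSeries G j) := by
    intro j hj
    induction hj using Nat.decreasingInduction with
    | self =>
      rw [hn]
      let _ : CommGroup (⊥ : Subgroup G) :=
        { (inferInstance : Group (⊥ : Subgroup G)) with
          mul_comm := fun _ _ ↦ Subsingleton.elim _ _ }
      exact isRankBounded_of_commGroup_fg (⊥ : Subgroup G)
    | of_succ j _ ih =>
      have : Group.FG (derivedSeries G j) := (Group.fg_iff_subgroup_fg _).mpr (hfg _)
      have hle : derivedSeries G (j + 1) ≤ derivedSeries G j := derivedSeries_antitone G j.le_succ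
      have : Group.FG (Abelianization (derivedSeries G j)) := QuotientGroup.fg _
      refine ih.of_exact (isRankBounded_of_commGroup_fg (Abelianization (derivedSeries G j)))
        (Subgroup.inclusion_injective hle) Abelianization.of ?_
      rw [Abelianization.ker_of]
      apply Subgroup.map_injective (derivedSeries G j).subtype_injective
      rw [Subgroup.map_subtype_commutator, ← derivedSeries_succ, ← MonoidHom.range_comp,
        Subgroup.subtype_comp_inclusion, Subgroup.range_subtype]
  exact (key 0 n.zero_le).of_finiteIndex (K := derivedSeries G 0)
    (by rw [derivedSeries_zero]; infer_instance)

end IsRankBounded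

/-- The supremum of the orders of the finite normal subgroups of `H`. -/
noncomputable def finiteNormalBound (H : Type*) [Group H] : ℕ :=
  sSup {n | ∃ F : Subgroup H, F.Normal ∧ Finite F ∧ Nat.card F = n}

section Retract

variable {G H H' : Type*} [Group G] [Group H] [Group H']

theorem finiteNormalBound_spec {m : ℕ} (hm : ∀ F : Subgroup H, Finite F → Nat.card F ≤ m) :
    finiteNormalBound H ≤ m ∧
      (∃ F : Subgroup H, F.Normal ∧ Finite F ∧ Nat.card F = finiteNormalBound H) ∧
      ∀ F : Subgroup H, F.Normal → Finite F → Nat.card F ≤ finiteNormalBound H := by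
  have hne : {n | ∃ F : Subgroup H, F.Normal ∧ Finite F ∧ Nat.card F = n}.Nonempty :=
    ⟨_, ⊥, inferInstance, inferInstance, rfl⟩
  have hbd : ∀ n ∈ {n | ∃ F : Subgroup H, F.Normal ∧ Finite F ∧ Nat.card F = n}, n ≤ m := by
    rintro n ⟨F, -, hF, rfl⟩
    exact hm F hF
  exact ⟨csSup_le hne hbd, Nat.sSup_mem hne ⟨m, hbd⟩,
    fun F hn hF ↦ le_csSup ⟨m, hbd⟩ ⟨F, hn, hF, rfl⟩⟩

theorem card_finite_subgroup_le_of_injective {m : ℕ}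
    (hm : ∀ F : Subgroup G, Finite F → Nat.card F ≤ m)
    {e : H →* G} (he : Function.Injective e) (F : Subgroup H) (hF : Finite F) :
    Nat.card F ≤ m := by
  rw [← Subgroup.card_map_of_injective he]
  exact hm _ (Finite.of_surjective _ (e.subgroupMap_surjective F))

theorem finite_ker_of_retract {g : H →* H'} {f : H' →* H} (hgf : ∀ x, g (f x) = x)
    (h : f.range.index ≠ 0) : Finite g.ker := by
  have hbot : f.range ⊓ g.ker = ⊥ := by
    rw [eq_bot_iff]
    rintro _ ⟨⟨x, rfl⟩, hx⟩
    have hx' : x = 1 := (hgf x).symm.trans hx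
    simp [hx']
  refine Nat.finite_of_card_ne_zero ?_
  rw [← Subgroup.relIndex_bot_left, ← hbot, Subgroup.inf_relIndex_right]
  exact fun h₀ ↦ h (Subgroup.index_eq_zero_of_relIndex_eq_zero h₀)

theorem finiteNormalBound_lt_of_finite_ker {m : ℕ}
    (hm : ∀ F : Subgroup H, Finite F → Nat.card F ≤ m)
    (hm' : ∀ F : Subgroup H', Finite F → Nat.card F ≤ m)
    {g : H →* H'} (hg : Function.Surjective g) (hfin : Finite g.ker) (hker : g.ker ≠ ⊥) :
    finiteNormalBound H' < finiteNormalBound H := by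
  obtain ⟨-, ⟨F, hFn, hF, hcard⟩, -⟩ := finiteNormalBound_spec hm'
  have hc : Nat.card (F.comap g) = Nat.card g.ker * Nat.card F := by
    rw [Subgroup.card_eq_card_inf_mul_relIndex (F.comap g) g.ker, Subgroup.relIndex_ker,
      Subgroup.map_comap_eq_self_of_surjective hg, inf_eq_left.mpr (Subgroup.ker_le_comap g F)]
  have hpos : 0 < Nat.card F := Nat.card_pos
  have hone : 1 < Nat.card g.ker :=
    (Subgroup.one_lt_card_iff_ne_bot _).mpr hker
  have hF' : Finite (F.comap g) := Nat.finite_of_card_ne_zero (by rw [hc]; positivity)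
  have := (finiteNormalBound_spec hm).2.2 (F.comap g) (hFn.comap g) hF'
  rw [hc, hcard] at this
  rw [hcard] at hpos
  nlinarith

/-- The potential of a subgroup embedding drops along proper retracts. -/
theorem potential_lt_of_retract {r : Subgroup G → ℕ} {m : ℕ}
    (hr : ∀ A B, A ≤ B → r A ≤ r B ∧ (A.relIndex B = 0 → r A < r B))
    (hm : ∀ F : Subgroup G, Finite F → Nat.card F ≤ m)
    {e : H →* G} (he : Function.Injective e) {g : H →* H'} {f : H' →* H}
    (hgf : ∀ x, g (f x) = x) (hiso : ¬ Nonempty (H ≃* H')) :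
    r (e.comp f).range * (m + 1) + finiteNormalBound H' <
      r e.range * (m + 1) + finiteNormalBound H := by
  have hf : Function.Injective f := Function.LeftInverse.injective hgf
  have hg : Function.Surjective g := Function.RightInverse.surjective hgf
  have hm₁ := card_finite_subgroup_le_of_injective hm he
  have hm₂ := card_finite_subgroup_le_of_injective hm₁ hf
  obtain ⟨hr₁, hr₂⟩ := hr (e.comp f).range e.range (by
    rw [MonoidHom.range_comp]; exact Subgroup.map_le_range e _)
  have hidx : (e.comp f).range.relIndex e.range = f.range.index := by
    rw [MonoidHom.range_comp, MonoidHom.range_eq_map e,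
      Subgroup.relIndex_map_map_of_injective _ _ he, Subgroup.relIndex_top_right]
  rw [hidx] at hr₂
  by_cases h : f.range.index = 0
  · have h₁ := hr₂ h
    have h₂ := (finiteNormalBound_spec hm₂).1
    nlinarith
  · have hker : g.ker ≠ ⊥ := fun hk ↦
      hiso ⟨MulEquiv.ofBijective g ⟨(MonoidHom.ker_eq_bot_iff g).mp hk, hg⟩⟩
    exact add_lt_add_of_le_of_lt (Nat.mul_le_mul_right _ hr₁)
      (finiteNormalBound_lt_of_finite_ker hm₁ hm₂ hg (finite_ker_of_retract hgf h) hker)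

end Retract

/-- The depth of every virtually polycyclic group is finite: there is a `k` such that
there is no chain `H_{k+1} <ᵖ ⋯ <ᵖ H_1 ≤ᵈ G` of length `k + 1` for `G`. -/
theorem depth_of_virtually_polycyclic_finite (G : Type v) [Group G]
    (hG : IsVirtuallyPolycyclic G) :
    ∃ k : ℕ, ∀ (H : ℕ → Type u) (inst : ∀ n, Group (H n)),
      ¬ (GrpDominatedI (H 1) G (inst 1) inferInstance ∧
        ∀ i, 1 ≤ i → i ≤ k → GrpPDomI (H (i + 1)) (H i) (inst (i + 1)) (inst i)) := by
  obtain ⟨K, hK, hsol, hfg⟩ := hG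
  have : Group.IsSolvable K := hsol
  obtain ⟨⟨r, hr⟩, m, hm⟩ := (IsRankBounded.of_isSolvable hfg).of_finiteIndex hK
  refine ⟨r ⊤ * (m + 1) + m + 1, fun H inst ⟨hdom, hchain⟩ ↦ ?_⟩
  have key : ∀ i ≤ r ⊤ * (m + 1) + m + 1, ∃ e : H (i + 1) →* G, Function.Injective e ∧
      r e.range * (m + 1) + (finiteNormalBound (H (i + 1)) + i) ≤ r ⊤ * (m + 1) + m := by
    intro i
    induction i with
    | zero =>
      intro _
      obtain ⟨g, f, hgf⟩ := hdom
      have hf : Function.Injective f := Function.LeftInverse.injective hgf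
      exact ⟨f, hf, Nat.add_le_add (Nat.mul_le_mul_right _ (hr _ _ le_top).1)
        (finiteNormalBound_spec (card_finite_subgroup_le_of_injective hm hf)).1⟩
    | succ i ih =>
      intro hi
      obtain ⟨e, he, hle⟩ := ih (by omega)
      obtain ⟨⟨g, f, hgf⟩, hiso⟩ := hchain (i + 1) (by omega) hi
      have := potential_lt_of_retract hr hm he hgf fun ⟨φ⟩ ↦ hiso ⟨φ.symm⟩
      exact ⟨e.comp f, he.comp (Function.LeftInverse.injective hgf), by omega⟩
  obtain ⟨e, -, hle⟩ := key _ le_rfl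
  omega
end

section
/- Let G be a virtually polycyclic group (G has a finite-index subgroup that is solvable and all of whose subgroups are finitely generated) and let M be a finitely generated module over the integral group ring ℤG (the monoid algebra of G over ℤ). Then the depth of M in the category of ℤG-modules is finite: there exists a natural number k such that there are no ℤG-modules N_1, …, N_{k+1} with N_{k+1} <^p N_k <^p ⋯ <^p N_1 ≤^d M. -/
universe u v w

/-- `N ≤ᵈ M` in the category of `R`-modules (`N` is a retract of `M`), with explicitly
given module structures. -/
def ModDominatedI (R : Type w) [Ring R] (N : Type u) (M : Type v)
    (iN : AddCommGroup N) (iM : AddCommGroup M)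
    (jN : letI := iN; Module R N) (jM : letI := iM; Module R M) : Prop :=
  letI := iN; letI := iM; letI := jN; letI := jM
  ∃ (g : M →ₗ[R] N) (f : N →ₗ[R] M), ∀ x, g (f x) = x

/-- `N` and `M` are isomorphic `R`-modules, with explicitly given module structures. -/
def ModIsoI (R : Type w) [Ring R] (N : Type u) (M : Type v)
    (iN : AddCommGroup N) (iM : AddCommGroup M)
    (jN : letI := iN; Module R N) (jM : letI := iM; Module R M) : Prop :=
  letI := iN; letI := iM; letI := jN; letI := jM
  Nonempty (N ≃ₗ[R] M)

/-- `N <ᵖ M`: proper domination of `R`-modules. -/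
def ModPDomI (R : Type w) [Ring R] (N : Type u) (M : Type v)
    (iN : AddCommGroup N) (iM : AddCommGroup M)
    (jN : letI := iN; Module R N) (jM : letI := iM; Module R M) : Prop :=
  ModDominatedI R N M iN iM jN jM ∧ ¬ ModIsoI R N M iN iM jN jM

section Lattice

variable {α : Type*} [Lattice α]

/-- The interval `[a, b]` contains a family of `n` elements, none of them equal to `a`, which is
independent over `a`. -/
def HasIndepOver (a : α) : ℕ → α → Prop
  | 0, b => a ≤ b
  | n + 1, b => ∃ x c, a < x ∧ x ≤ b ∧ c ≤ b ∧ x ⊓ c ≤ a ∧ HasIndepOver a n c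

theorem HasIndepOver.le {a : α} : ∀ {n : ℕ} {b : α}, HasIndepOver a n b → a ≤ b
  | 0, _, h => h
  | _ + 1, _, ⟨_, _, hax, hxb, _⟩ => hax.le.trans hxb

theorem HasIndepOver.mono {a b b' : α} (hb : b ≤ b') :
    ∀ {n : ℕ}, HasIndepOver a n b → HasIndepOver a n b'
  | 0, h => le_trans h hb
  | _ + 1, ⟨x, c, hax, hxb, hcb, hxc, h⟩ => ⟨x, c, hax, hxb.trans hb, hcb.trans hb, hxc, h⟩

/-- `u` lies strictly above `a`, and any two elements of `(a, u]` have a meet different from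
`a`. -/
def IsUniformOver (a u : α) : Prop :=
  a < u ∧ ∀ y z, a < y → y ≤ u → a < z → z ≤ u → ¬ y ⊓ z ≤ a

variable [IsModularLattice α]

theorem IsUniformOver.exists_hasIndepOver_inf_le {a u : α} (hu : IsUniformOver a u) :
    ∀ {n : ℕ} {b : α}, HasIndepOver a (n + 1) b → ∃ c ≤ b, HasIndepOver a n c ∧ c ⊓ u ≤ a
  | 0, _, h => ⟨a, h.le, le_rfl, inf_le_left⟩
  | n + 1, b, ⟨x, c, hax, hxb, hcb, hxc, h⟩ => by
    obtain ⟨c', hc', hn, hcu⟩ := hu.exists_hasIndepOver_inf_le h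
    by_cases h1 : c ⊓ u ≤ a
    · exact ⟨c, hcb, h, h1⟩
    by_cases h2 : (c' ⊔ x) ⊓ u ≤ a
    · exact ⟨c' ⊔ x, sup_le (hc'.trans hcb) hxb,
        ⟨x, c', hax, le_sup_right, le_sup_left, (inf_le_inf_left x hc').trans hxc, hn⟩, h2⟩
    have hac : a ≤ c := h.le
    have hac' : a ≤ c' := hn.le
    have lt_of : ∀ {y : α}, a ≤ y → ¬ y ⊓ u ≤ a → a < y ⊓ u := fun h h' =>
      lt_of_le_not_ge (le_inf h hu.1.le) h'
    refine (hu.2 _ _ (lt_of hac h1) inf_le_right (lt_of (hac'.trans le_sup_left) h2) inf_le_right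
      ?_).elim
    have key : (c' ⊔ x) ⊓ c ≤ c' := by
      rw [sup_inf_assoc_of_le x hc']
      exact sup_le le_rfl (hxc.trans hac')
    exact (le_inf ((le_inf (inf_le_right.trans inf_le_left)
      (inf_le_left.trans inf_le_left)).trans key) (inf_le_left.trans inf_le_right)).trans hcu

theorem HasIndepOver.sup {a u : α} (hau : a ≤ u) :
    ∀ {n : ℕ} {c : α}, HasIndepOver a n c → c ⊓ u ≤ a → HasIndepOver u n (c ⊔ u)
  | 0, _, _, _ => le_sup_right (α := α)
  | n + 1, b, ⟨x, c, hax, hxb, hcb, hxc, h⟩, hb => by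
    refine ⟨x ⊔ u, c ⊔ u, ?_, sup_le_sup_right hxb u, sup_le_sup_right hcb u, ?_,
      h.sup hau ((inf_le_inf_right u hcb).trans hb)⟩
    · refine lt_of_le_not_ge le_sup_right fun hxu => ?_
      exact hax.not_ge ((le_inf hxb (le_sup_left.trans hxu)).trans hb)
    · have h1 : x ⊓ (c ⊔ u) ≤ c := by
        refine (inf_le_inf_right _ hxb).trans ?_
        rw [inf_comm, sup_inf_assoc_of_le u hcb, inf_comm]
        exact sup_le le_rfl (hb.trans h.le)
      rw [sup_comm x u, sup_inf_assoc_of_le x le_sup_right]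
      exact sup_le le_rfl ((le_inf inf_le_left h1).trans (hxc.trans hau))

variable [OrderTop α] [WellFoundedGT α]

theorem exists_isUniformOver {a : α} (ha : a < ⊤) : ∃ u, IsUniformOver a u := by
  obtain ⟨c, ⟨hac, u, hau, hcu⟩, hmax⟩ := wellFounded_gt.has_min
    {c : α | a ≤ c ∧ ∃ u, a < u ∧ c ⊓ u ≤ a} ⟨a, le_rfl, ⊤, ha, inf_le_left⟩
  refine ⟨u, hau, fun y z hay hyu haz hzu hyz => ?_⟩
  refine hmax (y ⊔ c) ⟨hac.trans le_sup_right, z, haz, ?_⟩ (lt_of_le_not_ge le_sup_right ?_)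
  · have h1 : (y ⊔ c) ⊓ u ≤ y := by
      rw [sup_inf_assoc_of_le c hyu]
      exact sup_le le_rfl (hcu.trans hay.le)
    exact (le_inf ((inf_le_inf_left _ hzu).trans h1) inf_le_right).trans hyz
  · intro h
    exact hay.not_ge ((le_inf (le_sup_left.trans h) hyu).trans hcu)

theorem exists_not_hasIndepOver_top (a : α) : ∃ n, ¬ HasIndepOver a n ⊤ := by
  induction a using WellFoundedGT.induction with
  | ind a ih =>
    rcases eq_or_lt_of_le (le_top : a ≤ ⊤) with rfl | ha
    · exact ⟨1, fun ⟨x, c, hx, _⟩ => hx.not_ge le_top⟩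
    · obtain ⟨u, hu⟩ := exists_isUniformOver ha
      obtain ⟨n, hn⟩ := ih u hu.1
      refine ⟨n + 1, fun h => hn ?_⟩
      obtain ⟨c, -, hc, hcu⟩ := hu.exists_hasIndepOver_inf_le h
      exact (hc.sup hu.1.le hcu).mono le_top

end Lattice

section SkewLaurent

variable {R S : Type*} [Ring R] [Ring S] (f : R →+* S) (t : S)

/-- The sums `∑ i < n, t ^ i * f (r i)`. -/
def rightPolynomials : ℕ → AddSubgroup S
  | 0 => ⊥
  | n + 1 => rightPolynomials n ⊔ ((AddMonoidHom.mulLeft (t ^ n)).comp f.toAddMonoidHom).range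

variable {f t}

theorem mem_rightPolynomials_succ {n : ℕ} {x : S} :
    x ∈ rightPolynomials f t (n + 1) ↔ ∃ r, ∃ y ∈ rightPolynomials f t n, x = t ^ n * f r + y := by
  rw [rightPolynomials, AddSubgroup.mem_sup]
  constructor
  · rintro ⟨y, hy, _, ⟨r, rfl⟩, rfl⟩
    exact ⟨r, y, hy, add_comm _ _⟩
  · rintro ⟨r, y, hy, rfl⟩
    exact ⟨y, hy, _, ⟨r, rfl⟩, add_comm _ _⟩

theorem rightPolynomials_mono : Monotone (rightPolynomials f t) :=
  monotone_nat_of_le_succ fun _ => le_sup_left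

theorem mul_mem_rightPolynomials_succ :
    ∀ {n : ℕ} {x : S}, x ∈ rightPolynomials f t n → t * x ∈ rightPolynomials f t (n + 1)
  | 0, x, hx => by
    obtain rfl : x = 0 := hx
    simp
  | n + 1, x, hx => by
    obtain ⟨r, y, hy, rfl⟩ := mem_rightPolynomials_succ.1 hx
    exact mem_rightPolynomials_succ.2 ⟨r, t * y, mul_mem_rightPolynomials_succ hy, by
      rw [mul_add, ← mul_assoc, pow_succ']⟩

theorem pow_mul_mem_rightPolynomials {n : ℕ} {x : S} (hx : x ∈ rightPolynomials f t n) :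
    ∀ k : ℕ, t ^ k * x ∈ rightPolynomials f t (n + k)
  | 0 => by simpa using hx
  | k + 1 => by
    rw [pow_succ', mul_assoc]
    exact mul_mem_rightPolynomials_succ (pow_mul_mem_rightPolynomials hx k)

theorem exists_map_mul_pow (h₁ : ∀ r, ∃ r', f r * t = t * f r') (r : R) :
    ∀ n : ℕ, ∃ r', f r * t ^ n = t ^ n * f r'
  | 0 => ⟨r, by simp⟩
  | n + 1 => by
    obtain ⟨r', hr'⟩ := exists_map_mul_pow h₁ r n
    obtain ⟨r'', hr''⟩ := h₁ r'
    exact ⟨r'', by rw [pow_succ, ← mul_assoc, hr', mul_assoc, hr'', mul_assoc]⟩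

theorem exists_pow_mul_map (h₂ : ∀ r, ∃ r', t * f r = f r' * t) (r : R) :
    ∀ n : ℕ, ∃ r', t ^ n * f r = f r' * t ^ n
  | 0 => ⟨r, by simp⟩
  | n + 1 => by
    obtain ⟨r', hr'⟩ := exists_pow_mul_map h₂ r n
    obtain ⟨r'', hr''⟩ := h₂ r'
    exact ⟨r'', by rw [pow_succ', mul_assoc, hr', ← mul_assoc, hr'', mul_assoc]⟩

theorem map_mul_mem_rightPolynomials (h₁ : ∀ r, ∃ r', f r * t = t * f r') (s : R) :
    ∀ {n : ℕ} {x : S}, x ∈ rightPolynomials f t n → f s * x ∈ rightPolynomials f t n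
  | 0, x, hx => by
    obtain rfl : x = 0 := hx
    simp
  | n + 1, x, hx => by
    obtain ⟨r, y, hy, rfl⟩ := mem_rightPolynomials_succ.1 hx
    obtain ⟨s', hs'⟩ := exists_map_mul_pow h₁ s n
    exact mem_rightPolynomials_succ.2 ⟨s' * r, f s * y, map_mul_mem_rightPolynomials h₁ s hy, by
      rw [mul_add, ← mul_assoc, hs', mul_assoc, map_mul]⟩

/-- The left ideal of coefficients at `t ^ n` of the right polynomials of degree at most `n` lying
in the left ideal `I`. -/
def leadingCoeffIdeal (h₁ : ∀ r, ∃ r', f r * t = t * f r') (h₂ : ∀ r, ∃ r', t * f r = f r' * t)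
    (I : Ideal S) (n : ℕ) : Ideal R where
  carrier := {r | ∃ y ∈ rightPolynomials f t n, t ^ n * f r + y ∈ I}
  zero_mem' := ⟨0, zero_mem _, by simp⟩
  add_mem' := by
    rintro r s ⟨y, hy, hr⟩ ⟨z, hz, hs⟩
    refine ⟨y + z, add_mem hy hz, ?_⟩
    have : t ^ n * f (r + s) + (y + z) = (t ^ n * f r + y) + (t ^ n * f s + z) := by
      rw [map_add, mul_add]; abel
    rw [this]
    exact add_mem hr hs
  smul_mem' := by
    rintro s r ⟨y, hy, hr⟩
    obtain ⟨s', hs'⟩ := exists_pow_mul_map h₂ s n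
    refine ⟨f s' * y, map_mul_mem_rightPolynomials h₁ s' hy, ?_⟩
    have : t ^ n * f (s • r) + f s' * y = f s' * (t ^ n * f r + y) := by
      rw [smul_eq_mul, map_mul, ← mul_assoc, hs', mul_add, mul_assoc]
    rw [this]
    exact I.mul_mem_left _ hr

variable (h₁ : ∀ r, ∃ r', f r * t = t * f r') (h₂ : ∀ r, ∃ r', t * f r = f r' * t)

theorem leadingCoeffIdeal_mono {I J : Ideal S} (hIJ : I ≤ J) {m n : ℕ} (hmn : m ≤ n) :
    leadingCoeffIdeal h₁ h₂ I m ≤ leadingCoeffIdeal h₁ h₂ J n := by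
  rintro r ⟨y, hy, hr⟩
  obtain ⟨k, rfl⟩ := Nat.exists_eq_add_of_le hmn
  refine ⟨t ^ k * y, pow_mul_mem_rightPolynomials hy k, ?_⟩
  have : t ^ (m + k) * f r + t ^ k * y = t ^ k * (t ^ m * f r + y) := by
    rw [mul_add, ← mul_assoc, ← pow_add, add_comm k m]
  rw [this]
  exact J.mul_mem_left _ (hIJ hr)

theorem mem_of_leadingCoeffIdeal_le {I J : Ideal S} (hIJ : I ≤ J)
    (h : ∀ n, leadingCoeffIdeal h₁ h₂ J n ≤ leadingCoeffIdeal h₁ h₂ I n) :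
    ∀ {n : ℕ} {x : S}, x ∈ rightPolynomials f t n → x ∈ J → x ∈ I
  | 0, x, hx, _ => by
    obtain rfl : x = 0 := hx
    exact zero_mem _
  | n + 1, x, hx, hxJ => by
    obtain ⟨r, y, hy, rfl⟩ := mem_rightPolynomials_succ.1 hx
    obtain ⟨z, hz, hzI⟩ := h n ⟨y, hy, hxJ⟩
    have : y - z ∈ I := by
      refine mem_of_leadingCoeffIdeal_le hIJ h (sub_mem hy hz) ?_
      simpa using sub_mem hxJ (hIJ hzI)
    simpa using add_mem hzI this

include h₁ h₂ in
/-- **Hilbert's basis theorem** for rings generated by a left Noetherian ring together with a unit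
normalizing it. -/
theorem isNoetherianRing_of_pow_mul_mem_rightPolynomials [IsNoetherianRing R] (ht : IsUnit t)
    (h : ∀ x, ∃ k n, t ^ k * x ∈ rightPolynomials f t n) : IsNoetherianRing S := by
  refine isNoetherianRing_iff.2 (monotone_stabilizes_iff_noetherian.1 fun I => ?_)
  have stab : ∀ c : ℕ → Ideal R, Monotone c → ∃ n, ∀ m, n ≤ m → c n = c m := fun c hc =>
    monotone_stabilizes_iff_noetherian.2 inferInstance ⟨c, hc⟩
  obtain ⟨N, hN⟩ := stab (fun k => leadingCoeffIdeal h₁ h₂ (I k) k) (fun i j hij =>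
    leadingCoeffIdeal_mono h₁ h₂ (I.monotone hij) hij)
  choose B hB using fun n => stab (fun k => leadingCoeffIdeal h₁ h₂ (I k) n) (fun i j hij =>
    leadingCoeffIdeal_mono h₁ h₂ (I.monotone hij) le_rfl)
  refine ⟨N ⊔ (Finset.range N).sup B, fun m hm => le_antisymm (I.monotone hm) fun x hx => ?_⟩
  have key : ∀ n, leadingCoeffIdeal h₁ h₂ (I m) n ≤
      leadingCoeffIdeal h₁ h₂ (I (N ⊔ (Finset.range N).sup B)) n := by
    intro n
    rcases lt_or_ge n N with hn | hn
    · have hBn : B n ≤ N ⊔ (Finset.range N).sup B :=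
        (Finset.le_sup (f := B) (Finset.mem_range.2 hn)).trans le_sup_right
      rw [← hB n m (hBn.trans hm), ← hB n _ hBn]
    · refine (leadingCoeffIdeal_mono h₁ h₂ (I.monotone (le_max_left m n)) (le_max_right m n)).trans
        ?_
      rw [← hN (max m n) (hn.trans (le_max_right m n))]
      exact leadingCoeffIdeal_mono h₁ h₂ (I.monotone le_sup_left) hn
  obtain ⟨k, n, hkn⟩ := h x
  have := mem_of_leadingCoeffIdeal_le h₁ h₂ (I.monotone hm) key hkn ((I m).smul_mem _ hx)
  obtain ⟨u, hu⟩ := ht.pow k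
  rw [← hu] at this
  simpa using Ideal.mul_mem_left _ (↑u⁻¹ : S) this

end SkewLaurent

section GroupRing

open MonoidAlgebra

variable {k : Type*} [Ring k] {N H : Type*} [Group N] [Group H]

theorem isNoetherianRing_monoidAlgebra_of_surjective [IsNoetherianRing (MonoidAlgebra k N)]
    (φ : N →* H) (hφ : Function.Surjective φ) : IsNoetherianRing (MonoidAlgebra k H) := by
  refine isNoetherianRing_of_surjective _ _ (mapDomainRingHom k φ) fun x => ?_
  induction x using MonoidAlgebra.induction_linear with
  | zero => exact ⟨0, map_zero _⟩
  | add x y hx hy =>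
    obtain ⟨a, rfl⟩ := hx
    obtain ⟨b, rfl⟩ := hy
    exact ⟨a + b, map_add _ _ _⟩
  | single h a =>
    obtain ⟨n, rfl⟩ := hφ h
    exact ⟨single n a, by simp⟩

/-- The group ring of a group generated by a normal subgroup with Noetherian group ring together
with one more element is Noetherian. -/
theorem isNoetherianRing_monoidAlgebra_of_zpow_mul [IsNoetherianRing (MonoidAlgebra k N)]
    (φ : N →* H) (hφ : φ.range.Normal) (t : H) (h : ∀ x, ∃ (m : ℤ) (n : N), x = t ^ m * φ n) :
    IsNoetherianRing (MonoidAlgebra k H) := by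
  let f := mapDomainRingHom k φ
  let τ : MonoidAlgebra k H := single t 1
  have h₁ : ∀ r, ∃ r', f r * τ = τ * f r' := by
    intro r
    induction r using MonoidAlgebra.induction_linear with
    | zero => exact ⟨0, by simp⟩
    | add x y hx hy =>
      obtain ⟨a, ha⟩ := hx
      obtain ⟨b, hb⟩ := hy
      exact ⟨a + b, by rw [map_add, map_add, add_mul, mul_add, ha, hb]⟩
    | single n a =>
      obtain ⟨n', hn'⟩ := hφ.conj_mem (φ n) ⟨n, rfl⟩ t⁻¹
      exact ⟨single n' a, by simp [f, τ, hn', mul_assoc]⟩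
  have h₂ : ∀ r, ∃ r', τ * f r = f r' * τ := by
    intro r
    induction r using MonoidAlgebra.induction_linear with
    | zero => exact ⟨0, by simp⟩
    | add x y hx hy =>
      obtain ⟨a, ha⟩ := hx
      obtain ⟨b, hb⟩ := hy
      exact ⟨a + b, by rw [map_add, map_add, add_mul, mul_add, ha, hb]⟩
    | single n a =>
      obtain ⟨n', hn'⟩ := hφ.conj_mem (φ n) ⟨n, rfl⟩ t
      exact ⟨single n' a, by simp [f, τ, hn']⟩
  have hτ : IsUnit τ := (Group.isUnit t).map (MonoidAlgebra.of k H)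
  refine isNoetherianRing_of_pow_mul_mem_rightPolynomials h₁ h₂ hτ fun x => ?_
  induction x using MonoidAlgebra.induction_linear with
  | zero => exact ⟨0, 0, by simp⟩
  | add x y hx hy =>
    obtain ⟨i, m, hx⟩ := hx
    obtain ⟨j, n, hy⟩ := hy
    refine ⟨i + j, (m + j) ⊔ (n + i), ?_⟩
    rw [mul_add]
    refine add_mem (rightPolynomials_mono le_sup_left ?_) (rightPolynomials_mono le_sup_right ?_)
    · rw [add_comm i j, pow_add, mul_assoc]
      exact pow_mul_mem_rightPolynomials hx j
    · rw [pow_add, mul_assoc]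
      exact pow_mul_mem_rightPolynomials hy i
  | single g a =>
    obtain ⟨m, n, rfl⟩ := h g
    refine ⟨m.natAbs, (m.natAbs + m).toNat + 1, ?_⟩
    refine mem_rightPolynomials_succ.2 ⟨single n a, 0, zero_mem _, ?_⟩
    have hm : t ^ m.natAbs * (t ^ m * φ n) = t ^ (m.natAbs + m).toNat * φ n := by
      rw [← mul_assoc, ← zpow_natCast, ← zpow_add, ← zpow_natCast, Int.toNat_of_nonneg (by omega)]
    simp [f, τ, hm]

theorem isNoetherianRing_monoidAlgebra_of_commutator_le [IsNoetherianRing (MonoidAlgebra k N)]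
    (φ : N →* H) (hφ : commutator H ≤ φ.range) [hH : Group.FG H] :
    IsNoetherianRing (MonoidAlgebra k H) := by
  obtain ⟨s, hs⟩ := Group.fg_def.1 hH
  have key : ∀ s : Finset H, IsNoetherianRing
      (MonoidAlgebra k ↥(φ.range ⊔ Subgroup.closure (s : Set H))) := by
    classical
    intro s
    induction s using Finset.induction_on with
    | empty =>
      refine isNoetherianRing_monoidAlgebra_of_surjective
        (φ.codRestrict (φ.range ⊔ Subgroup.closure ((∅ : Finset H) : Set H))
          fun n => Subgroup.mem_sup_left ⟨n, rfl⟩) ?_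
      rintro ⟨x, hx⟩
      obtain ⟨n, rfl⟩ : x ∈ φ.range := by simpa using hx
      exact ⟨n, rfl⟩
    | insert t s _ ih =>
      set L := φ.range ⊔ Subgroup.closure (s : Set H) with hL
      have hLn : L.Normal := Subgroup.Normal.of_commutator_le _ (hφ.trans le_sup_left)
      have hL' : φ.range ⊔ Subgroup.closure ((insert t s : Finset H) : Set H) =
          Subgroup.zpowers t ⊔ L := by
        rw [Finset.coe_insert, Set.insert_eq, Subgroup.closure_union, ← Subgroup.zpowers_eq_closure,
          hL, sup_left_comm]
      rw [hL']
      have hle : L ≤ Subgroup.zpowers t ⊔ L := le_sup_right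
      refine isNoetherianRing_monoidAlgebra_of_zpow_mul (Subgroup.inclusion hle) ?_
        ⟨t, Subgroup.mem_sup_left (Subgroup.mem_zpowers t)⟩ ?_
      · rw [Subgroup.inclusion_range]
        infer_instance
      · rintro ⟨x, hx⟩
        obtain ⟨_, ⟨m, rfl⟩, z, hz, rfl⟩ := Subgroup.mem_sup_of_normal_right.1 hx
        exact ⟨m, ⟨z, hz⟩, Subtype.ext rfl⟩
  have := key s
  rw [hs, sup_top_eq] at this
  exact isNoetherianRing_monoidAlgebra_of_surjective (⊤ : Subgroup H).subtype
    fun x => ⟨⟨x, trivial⟩, rfl⟩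

theorem isNoetherianRing_monoidAlgebra_of_isSolvable [IsNoetherianRing k] [Group.IsSolvable H]
    (hH : ∀ L : Subgroup H, L.FG) : IsNoetherianRing (MonoidAlgebra k H) := by
  obtain ⟨n, hn⟩ := Group.IsSolvable.solvable (G := H)
  have key : ∀ i ≤ n, IsNoetherianRing (MonoidAlgebra k (derivedSeries H i)) := by
    intro i hi
    induction hi using Nat.decreasingInduction with
    | self =>
      have : Subsingleton (derivedSeries H n) := by rw [hn]; infer_instance
      exact isNoetherianRing_of_ringEquiv k (uniqueRingEquiv (derivedSeries H n)).symm
    | of_succ i hi ih =>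
      have hle : derivedSeries H (i + 1) ≤ derivedSeries H i :=
        derivedSeries_antitone H (Nat.le_succ i)
      have : Group.FG (derivedSeries H i) := (Group.fg_iff_subgroup_fg _).2 (hH _)
      refine isNoetherianRing_monoidAlgebra_of_commutator_le (Subgroup.inclusion hle) ?_
      rw [Subgroup.inclusion_range]
      intro x hx
      have : (x : H) ∈ (commutator (derivedSeries H i)).map (derivedSeries H i).subtype :=
        ⟨x, hx, rfl⟩
      rwa [Subgroup.map_subtype_commutator] at this
  have := key 0 n.zero_le
  exact isNoetherianRing_monoidAlgebra_of_surjective (derivedSeries H 0).subtype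
    fun x => ⟨⟨x, trivial⟩, rfl⟩

theorem isNoetherianRing_monoidAlgebra_of_finiteIndex (K : Subgroup H) [K.FiniteIndex]
    [IsNoetherianRing (MonoidAlgebra k K)] : IsNoetherianRing (MonoidAlgebra k H) := by
  let f := mapDomainRingHom k K.subtype
  let : Module (MonoidAlgebra k K) (MonoidAlgebra k H) := Module.compHom _ f
  have hsmul : ∀ (r : MonoidAlgebra k K) (x : MonoidAlgebra k H), r • x = f r * x :=
    fun _ _ => rfl
  have : IsScalarTower (MonoidAlgebra k K) (MonoidAlgebra k H) (MonoidAlgebra k H) :=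
    ⟨fun r x y => by simp only [hsmul, smul_eq_mul, mul_assoc]⟩
  obtain ⟨T, hT, -⟩ := K.exists_isComplement_right 1
  have hTfin : T.Finite := hT.finite_right_iff.2 inferInstance
  have : Module.Finite (MonoidAlgebra k K) (MonoidAlgebra k H) := by
    refine ⟨Submodule.fg_def.2 ⟨(fun g => single g 1) '' T, hTfin.image _, ?_⟩⟩
    refine eq_top_iff.2 fun x _ => ?_
    induction x using MonoidAlgebra.induction_linear with
    | zero => exact zero_mem _
    | add x y hx hy => exact add_mem (hx trivial) (hy trivial)
    | single g a =>
      obtain ⟨⟨c, g'⟩, rfl⟩ := hT.surjective g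
      have : (single ((c : H) * g') a : MonoidAlgebra k H) = single c a • single (g' : H) 1 := by
        simp [hsmul, f]
      rw [this]
      exact Submodule.smul_mem _ _ (Submodule.subset_span ⟨g', g'.2, rfl⟩)
  exact IsNoetherianRing.of_finite (MonoidAlgebra k K) _

end GroupRing

/-- **Hall's theorem**: the group ring of a virtually polycyclic group over a Noetherian ring is
Noetherian. -/
theorem IsVirtuallyPolycyclic.isNoetherianRing_monoidAlgebra {G : Type*} [Group G]
    (hG : IsVirtuallyPolycyclic G) (k : Type*) [Ring k] [IsNoetherianRing k] :
    IsNoetherianRing (MonoidAlgebra k G) := by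
  obtain ⟨K, hK, hsol, hfg⟩ := hG
  have : Group.IsSolvable K := hsol
  have := isNoetherianRing_monoidAlgebra_of_isSolvable (k := k) hfg
  exact isNoetherianRing_monoidAlgebra_of_finiteIndex K

theorem hasIndepOver_range_of_chain {R : Type w} [Ring R] {M : Type v} [AddCommGroup M]
    [Module R M] : ∀ (k : ℕ) (N : ℕ → Type u) [∀ n, AddCommGroup (N n)] [∀ n, Module R (N n)],
    (∀ i, 1 ≤ i → i ≤ k →
      ModPDomI R (N (i + 1)) (N i) inferInstance inferInstance inferInstance inferInstance) →
    ∀ j : N 1 →ₗ[R] M, Function.Injective j →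
      HasIndepOver (⊥ : Submodule R M) k (LinearMap.range j)
  | 0, _, _, _, _, _, _ => bot_le (α := Submodule R M)
  | k + 1, N, _, _, h, j, hj => by
    obtain ⟨⟨g, f, hgf⟩, hiso⟩ := h 1 le_rfl (Nat.le_add_left 1 k)
    have hf : Function.Injective f := Function.LeftInverse.injective hgf
    refine ⟨(LinearMap.ker g).map j, LinearMap.range (j ∘ₗ f), bot_lt_iff_ne_bot.2 fun hb => ?_,
      LinearMap.map_le_range, LinearMap.range_comp_le_range f j, ?_,
      hasIndepOver_range_of_chain k (fun n => N (n + 1))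
        (fun i hi hik => h (i + 1) (Nat.le_add_left 1 i) (Nat.succ_le_succ hik)) (j ∘ₗ f)
        (hj.comp hf)⟩
    · have hg : Function.Injective g := by
        rw [← LinearMap.ker_eq_bot]
        exact Submodule.map_injective_of_injective hj (hb.trans (Submodule.map_bot j).symm)
      exact hiso ⟨(LinearEquiv.ofBijective g ⟨hg, Function.RightInverse.surjective hgf⟩).symm⟩
    · rintro _ ⟨⟨y, hy, rfl⟩, z, hz⟩
      obtain rfl : f z = y := hj hz
      have hz0 : z = 0 := (hgf z).symm.trans hy
      simp [hz0]

/-- The depth of a finitely generated module `M` over the integral group ring `ℤG` of a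
virtually polycyclic group `G` is finite: there is a `k` such that there is no chain
`N_{k+1} <ᵖ ⋯ <ᵖ N_1 ≤ᵈ M` of length `k + 1` for `M` in the category of `ℤG`-modules. -/
theorem depth_of_module_over_vp_group_finite (G : Type v) [Group G]
    (hG : IsVirtuallyPolycyclic G)
    (M : Type w) [AddCommGroup M] [Module (MonoidAlgebra ℤ G) M]
    (hM : Module.Finite (MonoidAlgebra ℤ G) M) :
    ∃ k : ℕ, ∀ (N : ℕ → Type u) (instA : ∀ n, AddCommGroup (N n))
      (instM : ∀ n, letI := instA n; Module (MonoidAlgebra ℤ G) (N n)),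
      ¬ (ModDominatedI (MonoidAlgebra ℤ G) (N 1) M (instA 1) inferInstance (instM 1)
            inferInstance ∧
        ∀ i, 1 ≤ i → i ≤ k →
          ModPDomI (MonoidAlgebra ℤ G) (N (i + 1)) (N i) (instA (i + 1)) (instA i)
            (instM (i + 1)) (instM i)) := by
  have := hG.isNoetherianRing_monoidAlgebra ℤ
  have : IsNoetherian (MonoidAlgebra ℤ G) M := inferInstance
  obtain ⟨k, hk⟩ := exists_not_hasIndepOver_top (⊥ : Submodule (MonoidAlgebra ℤ G) M)
  refine ⟨k, fun N instA instM => ?_⟩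
  rintro ⟨⟨g, f, hgf⟩, h⟩
  exact hk ((hasIndepOver_range_of_chain k N h f
    (Function.LeftInverse.injective hgf)).mono le_top)
end

section
/- Let H_0, H_1, …, H_k be Hopfian groups together with homomorphisms g_i : H_{i−1} → H_i and f_i : H_i → H_{i−1} satisfying g_i ∘ f_i = id_{H_i} for each 1 ≤ i ≤ k (so H_k ≤^d ⋯ ≤^d H_1 ≤^d H_0 is a chain of r-images). If for some 1 ≤ j_0 ≤ k the group H_{j_0} is not isomorphic to H_{j_0 − 1}, then H_{j_0} is not isomorphic to H_i for any 0 ≤ i < j_0. -/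
universe u

/-- Composing the maps of a chain of surjective homomorphisms gives a surjective homomorphism. -/
theorem exists_surjective_hom_of_chain {H : ℕ → Type u} [∀ n, Group (H n)]
    (g : ∀ i, H i →* H (i + 1)) {i m : ℕ} (him : i ≤ m)
    (hg : ∀ n, n < m → Function.Surjective (g n)) :
    ∃ s : H i →* H m, Function.Surjective s := by
  induction m, him using Nat.le_induction with
  | base => exact ⟨MonoidHom.id _, Function.surjective_id⟩
  | succ n _ ih =>
    obtain ⟨s, hs⟩ := ih fun l hl => hg l (hl.trans n.lt_succ_self)
    exact ⟨(g n).comp s, (hg n n.lt_succ_self).comp hs⟩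

/-- Given Hopfian groups `H_0, …, H_k` with r-homomorphisms `g i : H i →* H (i+1)`
admitting converse homomorphisms `f i` (so `H_k ≤ᵈ ⋯ ≤ᵈ H_1 ≤ᵈ H_0`), if `H j₀` is not
isomorphic to `H (j₀ - 1)` for some `1 ≤ j₀ ≤ k`, then `H j₀` is not isomorphic to any
`H i` with `i < j₀`. -/
theorem hopfian_chain_nonIso (k : ℕ) (H : ℕ → Type u) [∀ n, Group (H n)]
    (hHopf : ∀ n, n ≤ k → IsHopfianGroup (H n))
    (g : ∀ i, H i →* H (i + 1)) (f : ∀ i, H (i + 1) →* H i)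
    (hgf : ∀ i, i + 1 ≤ k → ∀ x, g i (f i x) = x)
    (j₀ : ℕ) (hj₀ : 1 ≤ j₀) (hj₀k : j₀ ≤ k)
    (hne : ¬ Nonempty (H j₀ ≃* H (j₀ - 1))) :
    ∀ i, i < j₀ → ¬ Nonempty (H j₀ ≃* H i) := by
  rintro i hi ⟨e⟩
  obtain ⟨m, rfl⟩ : ∃ m, j₀ = m + 1 := ⟨j₀ - 1, by omega⟩
  have hsurj : ∀ n, n < m + 1 → Function.Surjective (g n) := fun n hn x =>
    ⟨f n x, hgf n (by omega) x⟩
  obtain ⟨s, hs⟩ := exists_surjective_hom_of_chain g (Nat.lt_succ_iff.mp hi)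
    fun n hn => hsurj n (by omega)
  have hgm := hsurj m m.lt_succ_self
  have hinj := hHopf m (by omega) ((s.comp e.toMonoidHom).comp (g m))
    ((hs.comp e.surjective).comp hgm)
  have hgm_inj : Function.Injective (g m) :=
    Function.Injective.of_comp (f := s.comp e.toMonoidHom) hinj
  exact hne ⟨(MulEquiv.ofBijective (g m) ⟨hgm_inj, hgm⟩).symm⟩
end
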